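/- arXiv:1509.08859 — 2 statements merged into one kernel-verified Lean document; each statement's English description precedes it below -/
import Mathlib

section
/- Let n ≥ 4 and let P ⊂ EuclideanSpace ℝ (Fin 3) be the convex hull of a finite set of points such that the set of extreme points of P has exactly n elements. If P contains a closed ball of radius r > 0 (centered at some point c), then vol(P) ≥ (√3/2)·(n−2)·(3·tan²(ωₙ) − 1)·r³, where ωₙ = (n/(n−2))·(π/6). (Left-hand side of L. Fejes Tóth's inequality (3), inradius/vertex version.) -/
open MeasureTheory Real

lemma ft_quad (p q r a b : ℝ) (hr : 0 < r) (h : 0 ≤ p * r - q ^ 2) :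
    0 ≤ p * a ^ 2 + 2 * q * a * b + r * b ^ 2 := by
  have : 0 ≤ r * (p * a ^ 2 + 2 * q * a * b + r * b ^ 2) := by
    have : r * (p * a ^ 2 + 2 * q * a * b + r * b ^ 2) = (q * a + r * b) ^ 2 + (p * r - q ^ 2) * a ^ 2 := by ring
    rw [this]; positivity
  exact nonneg_of_mul_nonneg_right this hr

noncomputable def ftF (t k : ℝ) : ℝ := t * (t ^ 2 * k ^ 2 - 1) / (1 + t ^ 2)

lemma ft_hasDerivAt_tan (u v s : ℝ) (h0 : 0 < u + s * v) (h1 : u + s * v < π / 2) :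
    HasDerivAt (fun s => tan (u + s * v)) (v * (1 + tan (u + s * v) ^ 2)) s := by
  have hc : cos (u + s * v) ≠ 0 := (cos_pos_of_mem_Ioo ⟨by linarith [pi_pos], h1⟩).ne'
  have h2 : HasDerivAt (fun s : ℝ => u + s * v) v s := by
    simpa using ((hasDerivAt_id s).mul_const v).const_add u
  have := (Real.hasDerivAt_tan hc).comp s h2
  refine this.congr_deriv ?_
  rw [Real.tan_eq_sin_div_cos]
  field_simp
  rw [cos_sq_add_sin_sq, mul_one]

lemma ft_convex (a0 b0 a b : ℝ) (ha0 : a0 ∈ Set.Ioo 0 (π / 2)) (hb0 : b0 ∈ Set.Ioo 0 (π / 2))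
    (ha : a ∈ Set.Ioo 0 (π / 2)) (hb : b ∈ Set.Ioo 0 (π / 2)) :
    ftF (tan a) (tan b) ≥ ftF (tan a0) (tan b0)
      + (tan a0 ^ 2 * tan b0 ^ 2 * (3 + tan a0 ^ 2) - 1 + tan a0 ^ 2) / (1 + tan a0 ^ 2) * (a - a0)
      + 2 * tan a0 ^ 3 * tan b0 * (1 + tan b0 ^ 2) / (1 + tan a0 ^ 2) * (b - b0) := by
  set u := a - a0 with hu
  set v := b - b0 with hv
  have mem : ∀ x y : ℝ, x ∈ Set.Ioo 0 (π / 2) → y ∈ Set.Ioo 0 (π / 2) → ∀ s ∈ Set.Icc (0:ℝ) 1,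
      0 < x + s * (y - x) ∧ x + s * (y - x) < π / 2 := by
    intro x y hx hy s hs
    have := (convex_Ioo (0:ℝ) (π/2)) hx hy (sub_nonneg.2 hs.2) hs.1 (by ring)
    simp only [smul_eq_mul] at this
    have e : x + s * (y - x) = (1 - s) * x + s * y := by ring
    rw [e]; exact this
  let T := fun s : ℝ => tan (a0 + s * u)
  let K := fun s : ℝ => tan (b0 + s * v)
  have hT : ∀ s ∈ Set.Icc (0:ℝ) 1, HasDerivAt T (u * (1 + T s ^ 2)) s := fun s hs =>
    ft_hasDerivAt_tan a0 u s (mem a0 a ha0 ha s hs).1 (mem a0 a ha0 ha s hs).2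
  have hK : ∀ s ∈ Set.Icc (0:ℝ) 1, HasDerivAt K (v * (1 + K s ^ 2)) s := fun s hs =>
    ft_hasDerivAt_tan b0 v s (mem b0 b hb0 hb s hs).1 (mem b0 b hb0 hb s hs).2
  have hTp : ∀ s ∈ Set.Icc (0:ℝ) 1, 0 < T s := fun s hs =>
    tan_pos_of_pos_of_lt_pi_div_two (mem a0 a ha0 ha s hs).1 (mem a0 a ha0 ha s hs).2
  have hKp : ∀ s ∈ Set.Icc (0:ℝ) 1, 0 < K s := fun s hs =>
    tan_pos_of_pos_of_lt_pi_div_two (mem b0 b hb0 hb s hs).1 (mem b0 b hb0 hb s hs).2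
  let f := fun s : ℝ => ftF (T s) (K s)
  let f' := fun s : ℝ => (T s ^ 2 * K s ^ 2 * (3 + T s ^ 2) - 1 + T s ^ 2) / (1 + T s ^ 2) * u
      + 2 * T s ^ 3 * K s * (1 + K s ^ 2) / (1 + T s ^ 2) * v
  let f'' := fun s : ℝ => 
    (2 * T s * (1 + T s ^ 2) * K s ^ 2 + 4 * T s * (1 + K s ^ 2) / (1 + T s ^ 2)) * u ^ 2
    + 2 * (T s ^ 2 * (3 + T s ^ 2) / (1 + T s ^ 2) * (2 * (1 + K s ^ 2) * K s)) * u * v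
    + (T s ^ 3 / (1 + T s ^ 2) * (2 * (1 + K s ^ 2) * (1 + 3 * K s ^ 2))) * v ^ 2
  have hf : ∀ s ∈ Set.Icc (0:ℝ) 1, HasDerivAt f (f' s) s := by
    intro s hs
    have h1 := hT s hs
    have h2 := hK s hs
    have hne : 1 + T s ^ 2 ≠ 0 := by positivity
    have := (h1.mul (((h1.pow 2).mul (h2.pow 2)).sub_const 1)).div ((h1.pow 2).const_add 1) hne
    refine this.congr_deriv ?_
    simp only [f', Pi.pow_apply, Pi.mul_apply]
    field_simp
    ring
  have hf' : ∀ s ∈ Set.Icc (0:ℝ) 1, HasDerivAt f' (f'' s) s := by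
    intro s hs
    have h1 := hT s hs
    have h2 := hK s hs
    have hne : 1 + T s ^ 2 ≠ 0 := by positivity
    have g1 := ((((h1.pow 2).mul (h2.pow 2)).mul ((h1.pow 2).const_add 3)).sub_const 1).add (h1.pow 2)
    have g2 := (g1.div ((h1.pow 2).const_add 1) hne).mul_const u
    have g3 := ((((h1.pow 3).const_mul 2).mul h2).mul ((h2.pow 2).const_add 1)).div
      ((h1.pow 2).const_add 1) hne
    have := g2.add (g3.mul_const v)
    refine this.congr_deriv ?_
    simp only [f'', Pi.pow_apply, Pi.mul_apply, Pi.add_apply]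
    field_simp
    ring
  have hpos : ∀ s ∈ Set.Icc (0:ℝ) 1, 0 ≤ f'' s := by
    intro s hs
    have h1 := hTp s hs
    have h2 := hKp s hs
    apply ft_quad
    · positivity
    · have : (2 * T s * (1 + T s ^ 2) * K s ^ 2 + 4 * T s * (1 + K s ^ 2) / (1 + T s ^ 2))
        * (T s ^ 3 / (1 + T s ^ 2) * (2 * (1 + K s ^ 2) * (1 + 3 * K s ^ 2)))
        - (T s ^ 2 * (3 + T s ^ 2) / (1 + T s ^ 2) * (2 * (1 + K s ^ 2) * K s)) ^ 2
        = 16 * (1 + K s ^ 2) * T s ^ 4 / (2 * (1 + T s ^ 2) ^ 2) * (K s ^ 2 * T s ^ 2 - 1) ^ 2 := by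
        field_simp
        ring
      rw [this]; positivity
  have hconv : ConvexOn ℝ (Set.Icc (0:ℝ) 1) f := by
    apply convexOn_of_hasDerivWithinAt2_nonneg (convex_Icc 0 1) (f' := f') (f'' := f'')
    · exact fun s hs => (hf s hs).continuousAt.continuousWithinAt
    · exact fun s hs => (hf s (interior_subset hs)).hasDerivWithinAt
    · exact fun s hs => (hf' s (interior_subset hs)).hasDerivWithinAt
    · exact fun s hs => hpos s (interior_subset hs)
  have h01 : (0:ℝ) ∈ Set.Icc (0:ℝ) 1 := by simp
  have h11 : (1:ℝ) ∈ Set.Icc (0:ℝ) 1 := by simp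
  have key := hconv.le_slope_of_hasDerivAt h01 h11 zero_lt_one (hf 0 h01)
  rw [slope_def_field] at key
  simp only [f, f', T, K, zero_mul, add_zero, one_mul, sub_zero, div_one] at key
  have e1 : a0 + u = a := by rw [hu]; ring
  have e2 : b0 + v = b := by rw [hv]; ring
  rw [e1, e2] at key
  linarith


lemma ft_inner (m : ℝ) (hm : 0 ≤ m) :
    ∫⁻ ρ in Set.Ioi (0:ℝ), ENNReal.ofReal ρ * ENNReal.ofReal (√(1 - ρ ^ 2) - m * ρ)
      ≤ ENNReal.ofReal ((1 - m / √(1 + m ^ 2)) / 3) := by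
  set D := √(1 + m ^ 2) with hD
  have hDp : 0 < D := by positivity
  have hD2 : D ^ 2 = 1 + m ^ 2 := by rw [hD, sq_sqrt]; positivity
  set R := 1 / D with hR
  have hRp : 0 < R := by positivity
  have hR2 : R ^ 2 * (1 + m ^ 2) = 1 := by rw [← hD2, hR]; field_simp
  have hR1 : R ^ 2 ≤ 1 := by nlinarith [sq_nonneg m, sq_nonneg (R * m)]
  have hun : Set.Ioi (0:ℝ) = Set.Ioc 0 R ∪ Set.Ioi R := (Set.Ioc_union_Ioi_eq_Ioi hRp.le).symm
  rw [hun, lintegral_union measurableSet_Ioi (Set.Ioc_disjoint_Ioi_same)]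
  have hz : ∫⁻ ρ in Set.Ioi R, ENNReal.ofReal ρ * ENNReal.ofReal (√(1 - ρ ^ 2) - m * ρ) = 0 := by
    rw [setLIntegral_congr_fun (g := fun _ => 0) measurableSet_Ioi]
    · simp
    · intro ρ hρ
      have hρ' : R < ρ := hρ
      have : √(1 - ρ ^ 2) - m * ρ ≤ 0 := by
        have h0 : 0 ≤ m * ρ := mul_nonneg hm (hRp.trans hρ').le
        rw [sub_nonpos, Real.sqrt_le_left h0]
        have : R ^ 2 ≤ ρ ^ 2 := by gcongr
        nlinarith [mul_le_mul_of_nonneg_right this (by positivity : 0 ≤ 1 + m ^ 2)]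
      simp [ENNReal.ofReal_of_nonpos this]
  rw [hz, add_zero]
  have hcongr : ∫⁻ ρ in Set.Ioc 0 R, ENNReal.ofReal ρ * ENNReal.ofReal (√(1 - ρ ^ 2) - m * ρ)
      = ∫⁻ ρ in Set.Ioc 0 R, ENNReal.ofReal (ρ * (√(1 - ρ ^ 2) - m * ρ)) := by
    apply setLIntegral_congr_fun measurableSet_Ioc
    intro ρ hρ
    simp only
    rw [ENNReal.ofReal_mul hρ.1.le]
  have hcont : Continuous (fun ρ : ℝ => ρ * (√(1 - ρ ^ 2) - m * ρ)) := by fun_prop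
  rw [hcongr, ← ofReal_integral_eq_lintegral_ofReal]
  · rw [← intervalIntegral.integral_of_le hRp.le]
    rw [intervalIntegral.integral_eq_sub_of_hasDerivAt_of_le hRp.le
      (f := fun ρ => -((1 - ρ ^ 2) * √(1 - ρ ^ 2)) / 3 - m * ρ ^ 3 / 3)]
    · apply ENNReal.ofReal_le_ofReal
      have hs : √(1 - R ^ 2) = m * R := by
        rw [Real.sqrt_eq_iff_mul_self_eq (by linarith) (by positivity)]
        nlinarith
      rw [hs]
      have : m / D = m * R := by rw [hR]; ring
      rw [this]
      simp
      nlinarith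
    · fun_prop
    · intro ρ hρ
      have h1 : 0 < 1 - ρ ^ 2 := by
        have : ρ ^ 2 < R ^ 2 := by have := hρ.1; have := hρ.2; gcongr
        linarith
      have g0 : HasDerivAt (fun ρ : ℝ => 1 - ρ ^ 2) (-(2 * ρ)) ρ := by
        simpa using ((hasDerivAt_id ρ).pow 2).const_sub 1
      have g1 := g0.sqrt h1.ne'
      have g2 := ((g0.mul g1).neg.div_const 3).sub ((((hasDerivAt_id ρ).pow 3).const_mul m).div_const 3)
      refine g2.congr_deriv ?_
      have h2 : √(1 - ρ ^ 2) ≠ 0 := (Real.sqrt_pos.2 h1).ne'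
      have h3 : √(1 - ρ ^ 2) ^ 2 = 1 - ρ ^ 2 := Real.sq_sqrt h1.le
      simp
      generalize √(1 - ρ ^ 2) = q at *
      rw [← h3]
      field_simp
      ring
    · exact hcont.intervalIntegrable _ _
  · exact (hcont.integrableOn_Icc).mono_set Set.Ioc_subset_Icc_self
  · filter_upwards [self_mem_ae_restrict measurableSet_Ioc] with ρ hρ
    simp only [Pi.zero_apply]
    apply mul_nonneg hρ.1.le
    rw [sub_nonneg]
    apply Real.le_sqrt_of_sq_le
    have : ρ ^ 2 ≤ R ^ 2 := by have := hρ.1; have := hρ.2; gcongr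
    nlinarith [mul_le_mul_of_nonneg_right this (by positivity : 0 ≤ 1 + m ^ 2)]

lemma ft_sector (S : Set ((ℝ × ℝ) × ℝ)) (hS : MeasurableSet S) (a b : ℝ) (m : ℝ → ℝ)
    (hm : Measurable m) (hm0 : ∀ θ ∈ Set.Icc a b, 0 ≤ m θ)
    (h : ∀ ρ θ z : ℝ, 0 < ρ → θ ∈ Set.Ioo (-π) π → ((ρ * cos θ, ρ * sin θ), z) ∈ S →
      θ ∈ Set.Icc a b ∧ m θ * ρ ≤ z ∧ ρ ^ 2 + z ^ 2 ≤ 1) :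
    volume S ≤ ∫⁻ θ in Set.Icc a b, ENNReal.ofReal ((1 - m θ / √(1 + m θ ^ 2)) / 3) := by
  have e1 : volume S = ∫⁻ p : ℝ × ℝ, volume (Prod.mk p ⁻¹' S) := by
    rw [Measure.volume_eq_prod, Measure.prod_apply hS]
  rw [e1, ← lintegral_comp_polarCoord_symm]
  let G : ℝ × ℝ → ENNReal := fun p => (Set.Ioi (0:ℝ) ×ˢ Set.Icc a b).indicator
    (fun p => ENNReal.ofReal p.1 * ENNReal.ofReal (√(1 - p.1 ^ 2) - m p.2 * p.1)) p
  have hG : Measurable G := by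
    apply Measurable.indicator
    · fun_prop
    · exact measurableSet_Ioi.prod measurableSet_Icc
  calc ∫⁻ p in polarCoord.target, ENNReal.ofReal p.1 • volume (Prod.mk (polarCoord.symm p) ⁻¹' S)
      ≤ ∫⁻ p in polarCoord.target, G p := by
        apply setLIntegral_mono hG
        rintro ⟨ρ, θ⟩ hp
        rw [polarCoord_target] at hp
        obtain ⟨h1, h2⟩ := hp
        have h1 : 0 < ρ := h1
        have h2 : θ ∈ Set.Ioo (-π) π := h2
        simp only [polarCoord_symm_apply, smul_eq_mul, G]
        by_cases hθ : θ ∈ Set.Icc a b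
        · rw [Set.indicator_of_mem (by exact ⟨h1, hθ⟩)]
          gcongr
          calc volume (Prod.mk (ρ * cos θ, ρ * sin θ) ⁻¹' S)
              ≤ volume (Set.Icc (m θ * ρ) (√(1 - ρ ^ 2))) := by
                apply measure_mono
                intro z hz
                obtain ⟨_, h4, h5⟩ := h ρ θ z h1 h2 hz
                exact ⟨h4, Real.le_sqrt_of_sq_le (by linarith)⟩
            _ = _ := by rw [Real.volume_Icc]
        · have : Prod.mk (ρ * cos θ, ρ * sin θ) ⁻¹' S = ∅ := by
            ext z
            simp only [Set.mem_preimage, Set.mem_empty_iff_false, iff_false]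
            intro hz
            exact hθ (h ρ θ z h1 h2 hz).1
          rw [this]; simp
    _ ≤ ∫⁻ p, G p := setLIntegral_le_lintegral _ _
    _ = ∫⁻ p in Set.Ioi (0:ℝ) ×ˢ Set.Icc a b, 
        ENNReal.ofReal p.1 * ENNReal.ofReal (√(1 - p.1 ^ 2) - m p.2 * p.1) := by
        rw [lintegral_indicator (measurableSet_Ioi.prod measurableSet_Icc)]
    _ = ∫⁻ θ in Set.Icc a b, ∫⁻ ρ in Set.Ioi (0:ℝ),
        ENNReal.ofReal ρ * ENNReal.ofReal (√(1 - ρ ^ 2) - m θ * ρ) := by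
        rw [Measure.volume_eq_prod, ← Measure.prod_restrict, lintegral_prod_symm]
        apply Measurable.aemeasurable
        fun_prop
    _ ≤ _ := by
        apply setLIntegral_mono' measurableSet_Icc
        intro θ hθ
        exact ft_inner _ (hm0 θ hθ)

lemma ft_angle (a b t0 d : ℝ) (hd : 0 < d) (hab : a ≤ b) :
    ∫⁻ θ in Set.Icc a b, ENNReal.ofReal ((1 - (cos (θ - t0) / d) / √(1 + (cos (θ - t0) / d) ^ 2)) / 3)
      = ENNReal.ofReal (((b - a) - (arcsin (sin (b - t0) / √(1 + d ^ 2))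
        - arcsin (sin (a - t0) / √(1 + d ^ 2)))) / 3) := by
  have hcont : Continuous (fun θ : ℝ => (1 - (cos (θ - t0) / d) / √(1 + (cos (θ - t0) / d) ^ 2)) / 3) := by
    have : ∀ θ : ℝ, √(1 + (cos (θ - t0) / d) ^ 2) ≠ 0 := fun θ => by positivity
    fun_prop (disch := exact this)
  rw [← ofReal_integral_eq_lintegral_ofReal]
  · rw [integral_Icc_eq_integral_Ioc, ← intervalIntegral.integral_of_le hab]
    rw [intervalIntegral.integral_eq_sub_of_hasDerivAt
      (f := fun θ => (θ - arcsin (sin (θ - t0) / √(1 + d ^ 2))) / 3)]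
    · congr 1; ring
    · intro θ _
      set D := √(1 + d ^ 2) with hD
      have hDp : 0 < D := by positivity
      have hD2 : D ^ 2 = 1 + d ^ 2 := by rw [hD, sq_sqrt]; positivity
      have hsq := sin_sq_add_cos_sq (θ - t0)
      have hlt : |sin (θ - t0) / D| < 1 := by
        rw [← sq_lt_one_iff_abs_lt_one, div_pow, div_lt_one (by positivity), hD2]
        nlinarith [sq_nonneg (cos (θ - t0)), sq_pos_of_pos hd]
      rw [abs_lt] at hlt
      have g1 := Real.hasDerivAt_arcsin hlt.1.ne' hlt.2.ne
      have g2 : HasDerivAt (fun θ => sin (θ - t0) / D) (cos (θ - t0) / D) θ := by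
        have := ((Real.hasDerivAt_sin (θ - t0)).comp θ ((hasDerivAt_id θ).sub_const t0)).div_const D
        simpa using this
      have g3 := ((hasDerivAt_id θ).sub (g1.comp θ g2)).div_const 3
      refine g3.congr_deriv ?_
      have e1 : √(1 - (sin (θ - t0) / D) ^ 2) = √(d ^ 2 + cos (θ - t0) ^ 2) / D := by
        rw [← Real.sqrt_sq hDp.le, ← Real.sqrt_div (by positivity), Real.sqrt_sq hDp.le]
        congr 1
        rw [div_pow, hD2]; field_simp; nlinarith
      have e2 : √(1 + (cos (θ - t0) / d) ^ 2) = √(d ^ 2 + cos (θ - t0) ^ 2) / d := by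
        rw [← Real.sqrt_sq hd.le, ← Real.sqrt_div (by positivity), Real.sqrt_sq hd.le]
        congr 1
        field_simp
      rw [e1, e2]
      have : √(d ^ 2 + cos (θ - t0) ^ 2) ≠ 0 := by positivity
      field_simp
    · exact hcont.intervalIntegrable _ _
  · exact hcont.integrableOn_Icc
  · apply Filter.Eventually.of_forall
    intro θ
    simp only [Pi.zero_apply]
    apply div_nonneg _ (by norm_num)
    rw [sub_nonneg, div_le_one (by positivity)]
    apply Real.le_sqrt_of_sq_le
    linarith


noncomputable def ftP (ω : ℝ) : ℝ := ftF (√3) (tan ω)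
noncomputable def ftB (ω : ℝ) : ℝ := 2 * √3 ^ 3 * tan ω * (1 + tan ω ^ 2) / (1 + √3 ^ 2)
noncomputable def ftA (ω : ℝ) : ℝ :=
  (√3 ^ 2 * tan ω ^ 2 * (3 + √3 ^ 2) - 1 + √3 ^ 2) / (1 + √3 ^ 2)

lemma ft_tangent (ω : ℝ) (hω : ω ∈ Set.Ioo 0 (π / 2)) (a b : ℝ)
    (ha : a ∈ Set.Ioo 0 (π / 2)) (hb : b ∈ Set.Ioo 0 (π / 2)) :
    ftF (tan a) (tan b) ≥ ftP ω + ftA ω * (a - π / 3) + ftB ω * (b - ω) := by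
  have h3 : π / 3 ∈ Set.Ioo 0 (π / 2) := ⟨by positivity, by linarith [pi_pos]⟩
  have := ft_convex (π / 3) ω a b h3 hω ha hb
  rw [Real.tan_pi_div_three] at this
  exact this

lemma ft_piece (ω : ℝ) (hω : ω ∈ Set.Ioo 0 (π / 2)) (a d : ℝ)
    (ha : a ∈ Set.Ioo 0 (π / 2)) (hd : 0 < d) :
    d ^ 2 * tan a ≥ ftP ω + ftA ω * (a - π / 3)
      + ftB ω * (π / 2 - arcsin (sin a / √(1 + d ^ 2)) - ω) := by
  set D := √(1 + d ^ 2) with hD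
  have hDp : 0 < D := by positivity
  have hD2 : D ^ 2 = 1 + d ^ 2 := by rw [hD, sq_sqrt]; positivity
  have hD1 : 1 < D := by nlinarith [sq_pos_of_pos hd]
  have hs : 0 < sin a := sin_pos_of_pos_of_lt_pi ha.1 (by linarith [ha.2, pi_pos])
  have hc : 0 < cos a := cos_pos_of_mem_Ioo ⟨by linarith [ha.1, pi_pos], ha.2⟩
  have hs1 : sin a ≤ 1 := sin_le_one a
  set q := sin a / D with hq
  have hq0 : 0 < q := by positivity
  have hq1 : q < 1 := by rw [hq, div_lt_one hDp]; linarith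
  have hb : π / 2 - arcsin q ∈ Set.Ioo 0 (π / 2) := by
    have h1 : 0 < arcsin q := arcsin_pos.2 hq0
    have h2 : arcsin q < π / 2 := arcsin_lt_pi_div_two.2 hq1
    exact ⟨by linarith, by linarith⟩
  have key := ft_tangent ω hω a _ ha hb
  have e : ftF (tan a) (tan (π / 2 - arcsin q)) = d ^ 2 * tan a := by
    have hk : tan (π / 2 - arcsin q) ^ 2 = D ^ 2 / sin a ^ 2 - 1 := by
      rw [tan_eq_sin_div_cos, sin_pi_div_two_sub, cos_pi_div_two_sub, sin_arcsin (by linarith) hq1.le,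
        cos_arcsin, div_pow, sq_sqrt (by nlinarith), hq]
      field_simp
    unfold ftF
    rw [hk, tan_eq_sin_div_cos, hD2]
    have h1 := sin_sq_add_cos_sq a
    have h2 : (1:ℝ) + (sin a / cos a) ^ 2 = 1 / cos a ^ 2 := by field_simp; linarith
    rw [h2]
    field_simp
    have h3 : sin a ^ 2 = 1 - cos a ^ 2 := by linarith
    rw [h3]; ring
  rw [e] at key
  exact key

def ftK (w e f : ℝ) : Set ((ℝ × ℝ) × ℝ) :=
  {p | 0 < p.2 ∧ -e * p.2 ≤ p.1.2 ∧ |p.1.1| * (e + f) ≤ w * (f * p.2 - p.1.2)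
    ∧ p.1.1 ^ 2 + p.1.2 ^ 2 + p.2 ^ 2 ≤ 1}

lemma ftK_meas (w e f : ℝ) : MeasurableSet (ftK w e f) := by
  unfold ftK
  simp only [measurableSet_setOfPred]
  refine Measurable.and (by measurability) (Measurable.and ?_ (Measurable.and ?_ ?_))
  · exact measurableSet_setOfPred.1 (measurableSet_le (by fun_prop) (by fun_prop))
  · exact measurableSet_setOfPred.1 (measurableSet_le (by fun_prop) (by fun_prop))
  · exact measurableSet_setOfPred.1 (measurableSet_le (by fun_prop) (by fun_prop))

lemma ft_tan_sub (x y : ℝ) (hx : cos x ≠ 0) (hy : cos y ≠ 0) :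
    tan (x - y) = (tan x - tan y) / (1 + tan x * tan y) := by
  rw [tan_eq_sin_div_cos, sin_sub, cos_sub, tan_eq_sin_div_cos, tan_eq_sin_div_cos]
  have h1 : sin x / cos x - sin y / cos y = (sin x * cos y - cos x * sin y) / (cos x * cos y) := by
    field_simp
  have h2 : 1 + sin x / cos x * (sin y / cos y) = (cos x * cos y + sin x * sin y) / (cos x * cos y) := by
    field_simp
  rw [h1, h2, div_div_div_cancel_right₀ (mul_ne_zero hx hy)]

lemma ft_half (w e f : ℝ) : volume (ftK w e f) ≤ 2 * volume (ftK w e f ∩ {p | 0 ≤ p.1.1}) := by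
  let φ : (ℝ × ℝ) × ℝ → (ℝ × ℝ) × ℝ := Prod.map (Prod.map (fun x => -x) id) id
  have hφ : MeasurePreserving φ volume volume := by
    refine MeasurePreserving.prod (MeasurePreserving.prod ?_ ?_) ?_
    · exact Measure.measurePreserving_neg _
    · exact MeasurePreserving.id _
    · exact MeasurePreserving.id _
  have hm : MeasurableSet (ftK w e f ∩ {p | 0 ≤ p.1.1}) :=
    (ftK_meas w e f).inter (measurableSet_le (by fun_prop) (by fun_prop))
  calc volume (ftK w e f) ≤ volume ((ftK w e f ∩ {p | 0 ≤ p.1.1}) ∪ φ ⁻¹' (ftK w e f ∩ {p | 0 ≤ p.1.1})) := by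
        apply measure_mono
        rintro ⟨⟨x, y⟩, z⟩ hp
        rcases le_total 0 x with h | h
        · left; exact ⟨hp, h⟩
        · right
          refine ⟨?_, ?_⟩
          · simpa [ftK, φ] using hp
          · simpa [φ] using h
    _ ≤ _ := by
        refine (measure_union_le _ _).trans ?_
        rw [hφ.measure_preimage hm.nullMeasurableSet, two_mul]

set_option maxHeartbeats 1000000 in
lemma ft_iso (ω : ℝ) (hω : ω ∈ Set.Ioo 0 (π / 2)) (w e f : ℝ) (hw : 0 < w) (he : 0 < e) (hf : 0 < f) :
    w * (e + f) / 3 ≥ ftP ω + ftB ω / 6 * (3 * (volume (ftK w e f)).toReal + π - 6 * ω) := by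
  set L := √((e + f) ^ 2 + w ^ 2) with hL
  have hLp : 0 < L := by positivity
  have hL2 : L ^ 2 = (e + f) ^ 2 + w ^ 2 := by rw [hL, sq_sqrt]; positivity
  set l := arctan (w / (e + f)) with hl
  set a1 := arctan (w / e) with ha1
  have hl0 : 0 < l := arctan_pos.2 (by positivity)
  have hl1 : l < π / 2 := arctan_lt_pi_div_two _
  have ha10 : 0 < a1 := arctan_pos.2 (by positivity)
  have ha11 : a1 < π / 2 := arctan_lt_pi_div_two _
  have hla : l < a1 := by
    apply arctan_strictMono
    gcongr
    linarith
  have hcosl : cos l = (e + f) / L := by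
    rw [hl, cos_arctan, hL]
    have : 1 + (w / (e + f)) ^ 2 = ((e + f) ^ 2 + w ^ 2) / (e + f) ^ 2 := by field_simp
    rw [this, sqrt_div (by positivity), sqrt_sq (by positivity)]
    field_simp
  have hsinl : sin l = w / L := by
    have := tan_mul_cos (x := l) (by rw [hcosl]; positivity)
    rw [← this, hcosl, hl, tan_arctan]
    field_simp
  set d := w * f / L with hd
  have hdp : 0 < d := by positivity
  set t1 := -(π / 2) + a1 with ht1
  let m : ℝ → ℝ := fun θ => if θ < t1 then cos (θ - (-(π / 2))) / e else cos (θ - l) / d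
  have hm : Measurable m := by
    apply Measurable.ite (measurableSet_lt (by fun_prop) (by fun_prop)) <;> fun_prop
  have hvol : volume (ftK w e f ∩ {p | 0 ≤ p.1.1}) ≤
      ∫⁻ θ in Set.Icc (-(π / 2)) (π / 2), ENNReal.ofReal ((1 - m θ / √(1 + m θ ^ 2)) / 3) := by
    apply ft_sector _ ((ftK_meas w e f).inter (measurableSet_le (by fun_prop) (by fun_prop))) _ _ _ hm
    · intro θ hθ
      simp only [m]
      split_ifs with h
      · apply div_nonneg _ he.le
        exact cos_nonneg_of_mem_Icc ⟨by linarith [hθ.1, pi_pos], by linarith⟩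
      · apply div_nonneg _ hdp.le
        exact cos_nonneg_of_mem_Icc ⟨by linarith, by linarith [hθ.2]⟩
    · rintro ρ θ z hρ hθ ⟨⟨h1, h2, h3, h4⟩, h5⟩
      simp only at h1 h2 h3 h4
      have h5 : 0 ≤ ρ * cos θ := h5
      have hc : 0 ≤ cos θ := nonneg_of_mul_nonneg_right h5 hρ
      refine ⟨⟨?_, ?_⟩, ?_, ?_⟩
      · by_contra hcon
        have := cos_neg_of_pi_div_two_lt_of_lt (x := -θ) (by linarith) (by linarith [hθ.1, pi_pos])
        rw [cos_neg] at this; linarith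
      · by_contra hcon
        have := cos_neg_of_pi_div_two_lt_of_lt (x := θ) (by linarith) (by linarith [hθ.2, pi_pos])
        linarith
      · simp only [m]
        split_ifs with h
        · have : cos (θ - -(π / 2)) = - sin θ := by rw [sub_neg_eq_add, cos_add_pi_div_two]
          rw [this, div_mul_eq_mul_div, div_le_iff₀ he]
          linarith
        · rw [div_mul_eq_mul_div, div_le_iff₀ hdp, cos_sub, hcosl, hsinl, hd]
          rw [abs_of_nonneg h5] at h3
          have : (cos θ * ((e + f) / L) + sin θ * (w / L)) * ρ = (ρ * cos θ * (e + f) + w * (ρ * sin θ)) / L := by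
            field_simp
          rw [this, mul_div_assoc', div_le_div_iff_of_pos_right hLp]
          linarith
      · have := sin_sq_add_cos_sq θ
        have e : ρ ^ 2 = (ρ * cos θ) ^ 2 + (ρ * sin θ) ^ 2 := by
          calc ρ ^ 2 = ρ ^ 2 * (sin θ ^ 2 + cos θ ^ 2) := by rw [this, mul_one]
            _ = _ := by ring
        rw [e]; exact h4
  have ht1a : -(π / 2) ≤ t1 := by linarith
  have ht1b : t1 ≤ π / 2 := by linarith
  have hsplit : ∫⁻ θ in Set.Icc (-(π / 2)) (π / 2), ENNReal.ofReal ((1 - m θ / √(1 + m θ ^ 2)) / 3)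
     ≤ ENNReal.ofReal (((t1 - (-(π / 2))) - (arcsin (sin (t1 - (-(π / 2))) / √(1 + e ^ 2))
        - arcsin (sin (-(π / 2) - (-(π / 2))) / √(1 + e ^ 2)))) / 3)
      + ENNReal.ofReal (((π / 2 - t1) - (arcsin (sin (π / 2 - l) / √(1 + d ^ 2))
        - arcsin (sin (t1 - l) / √(1 + d ^ 2)))) / 3) := by
    rw [← ft_angle _ _ _ e he ht1a, ← ft_angle _ _ _ d hdp ht1b,
      ← Set.Ico_union_Icc_eq_Icc ht1a ht1b]
    refine (lintegral_union_le _ _ _).trans ?_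
    apply add_le_add
    · refine (le_of_eq ?_).trans (lintegral_mono_set Set.Ico_subset_Icc_self)
      apply setLIntegral_congr_fun measurableSet_Ico
      intro θ hθ
      simp only [m, if_pos hθ.2]
    · apply le_of_eq
      apply setLIntegral_congr_fun measurableSet_Icc
      intro θ hθ
      simp only [m, if_neg (not_lt.2 hθ.1)]
  set a2 := π / 2 + l - a1 with ha2
  set a3 := π / 2 - l with ha3
  have e1 : t1 - -(π / 2) = a1 := by rw [ht1]; ring
  have e2 : t1 - l = - a2 := by rw [ht1, ha2]; ring
  have e3 : π / 2 - t1 = a2 + a3 := by rw [ht1, ha2, ha3]; ring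
  rw [e1, e2, e3, sub_self, sin_zero, zero_div, arcsin_zero, sub_zero, sin_neg, neg_div, arcsin_neg] at hsplit
  have m1 : a1 ∈ Set.Ioo 0 (π / 2) := ⟨ha10, ha11⟩
  have m2 : a2 ∈ Set.Ioo 0 (π / 2) := ⟨by linarith, by linarith⟩
  have m3 : a3 ∈ Set.Ioo 0 (π / 2) := ⟨by linarith, by linarith⟩
  have p1 := ft_piece ω hω a1 e m1 he
  have p2 := ft_piece ω hω a2 d m2 hdp
  have p3 := ft_piece ω hω a3 d m3 hdp
  set s1 := arcsin (sin a1 / √(1 + e ^ 2))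
  set s2 := arcsin (sin a2 / √(1 + d ^ 2))
  set s3 := arcsin (sin a3 / √(1 + d ^ 2))
  have arcle : ∀ x D : ℝ, x ∈ Set.Ioo 0 (π / 2) → 0 < D → arcsin (sin x / √(1 + D ^ 2)) ≤ x := by
    intro x D hx hD
    have hsin : 0 < sin x := sin_pos_of_pos_of_lt_pi hx.1 (by linarith [hx.2, pi_pos])
    calc arcsin (sin x / √(1 + D ^ 2)) ≤ arcsin (sin x) := by
          apply monotone_arcsin
          apply div_le_self hsin.le
          rw [Real.one_le_sqrt]; nlinarith
      _ = x := arcsin_sin (by linarith [hx.1, pi_pos]) hx.2.le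
  have q1 := arcle a1 e m1 he
  have q2 := arcle a2 d m2 hdp
  have q3 := arcle a3 d m3 hdp
  have hfin : (volume (ftK w e f)).toReal ≤ 2 * ((a1 - s1) / 3 + (a2 + a3 - s3 - s2) / 3) := by
    apply ENNReal.toReal_le_of_le_ofReal
    · have : 0 ≤ a1 - s1 := sub_nonneg.2 q1
      have : 0 ≤ a2 + a3 - s3 - s2 := by linarith
      positivity
    · refine (ft_half w e f).trans ?_
      rw [ENNReal.ofReal_mul (by norm_num), ENNReal.ofReal_add (div_nonneg (sub_nonneg.2 q1) (by norm_num)) (div_nonneg (by linarith) (by norm_num))]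
      gcongr
      · simp
      · refine (hvol.trans hsplit).trans ?_
        have e4 : a2 + a3 - (s3 - -s2) = a2 + a3 - s3 - s2 := by ring
        rw [e4]
  have hB : 0 ≤ ftB ω := by
    have := tan_pos_of_pos_of_lt_pi_div_two hω.1 hω.2
    unfold ftB; positivity
  have htan1 : tan a1 = w / e := tan_arctan _
  have htanl : tan l = w / (e + f) := tan_arctan _
  have htan3 : tan a3 = (e + f) / w := by rw [ha3, tan_pi_div_two_sub, htanl, inv_div]
  have htan2 : tan a2 = (e * (e + f) + w ^ 2) / (w * f) := by
    have : a2 = π / 2 - (a1 - l) := by rw [ha2]; ring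
    rw [this, tan_pi_div_two_sub, ft_tan_sub _ _ (cos_arctan_pos _).ne' (cos_arctan_pos _).ne', htan1, htanl, inv_div]
    have h1 : w / e - w / (e + f) = w * f / (e * (e + f)) := by field_simp; ring
    have h2 : 1 + w / e * (w / (e + f)) = (e * (e + f) + w ^ 2) / (e * (e + f)) := by field_simp
    rw [h1, h2, div_div_div_cancel_right₀ (by positivity)]
  have hsum : e ^ 2 * tan a1 + d ^ 2 * tan a2 + d ^ 2 * tan a3 = w * (e + f) := by
    rw [htan1, htan2, htan3, hd, div_pow, hL2]
    field_simp
    ring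
  have hA : a1 + a2 + a3 = π := by rw [ha2, ha3]; ring
  have hv := mul_le_mul_of_nonneg_left hfin (by positivity : 0 ≤ ftB ω / 2)
  have hAA : ftA ω * (a1 - π / 3) + ftA ω * (a2 - π / 3) + ftA ω * (a3 - π / 3) = 0 := by
    rw [← mul_add, ← mul_add]
    have : a1 - π / 3 + (a2 - π / 3) + (a3 - π / 3) = 0 := by linarith
    rw [this, mul_zero]
  have hBB : ftB ω * (a1 + a2 + a3) = ftB ω * π := by rw [hA]
  linarith


lemma ftB_nonneg (ω : ℝ) (hω : ω ∈ Set.Ioo 0 (π / 2)) : 0 ≤ ftB ω := by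
  have := tan_pos_of_pos_of_lt_pi_div_two hω.1 hω.2
  unfold ftB; positivity

lemma ftK_fin (w e f : ℝ) : volume (ftK w e f) < ⊤ := by
  apply Bornology.IsBounded.measure_lt_top
  refine (Bornology.IsBounded.prod (Bornology.IsBounded.prod (Metric.isBounded_Icc (-1:ℝ) 1)
    (Metric.isBounded_Icc (-1:ℝ) 1)) (Metric.isBounded_Icc (-1:ℝ) 1)).subset ?_
  rintro ⟨⟨x, y⟩, z⟩ ⟨h1, h2, h3, h4⟩
  simp only at h4
  refine ⟨⟨⟨?_, ?_⟩, ⟨?_, ?_⟩⟩, ⟨?_, ?_⟩⟩ <;> simp only <;> nlinarith [sq_nonneg x, sq_nonneg y, sq_nonneg z]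

lemma ft_iso' (ω : ℝ) (hω : ω ∈ Set.Ioo 0 (π / 2)) (w e f : ℝ) (hw : 0 < w) (he : 0 ≤ e) (hf : 0 ≤ f)
    (hef : 0 < e + f) :
    w * (e + f) / 3 ≥ ftP ω + ftB ω / 6 * (3 * (volume (ftK w e f)).toReal + π - 6 * ω) := by
  have hB := ftB_nonneg ω hω
  have key : ∀ ε > 0, ftP ω + ftB ω / 6 * (3 * (volume (ftK w e f)).toReal + π - 6 * ω)
      ≤ (w / (e + f) * (e + f + 2 * ε)) * (e + f + 2 * ε) / 3 := by
    intro ε hε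
    have h1 := ft_iso ω hω (w / (e + f) * (e + f + 2 * ε)) (e + ε) (f + ε) (by positivity) (by positivity) (by positivity)
    have h2 : (volume (ftK w e f)).toReal ≤ (volume (ftK (w / (e + f) * (e + f + 2 * ε)) (e + ε) (f + ε))).toReal := by
      apply ENNReal.toReal_mono (ftK_fin _ _ _).ne
      apply measure_mono
      rintro ⟨⟨x, y⟩, z⟩ ⟨h1, h2, h3, h4⟩
      simp only at h1 h2 h3 h4
      refine ⟨h1, ?_, ?_, h4⟩ <;> simp only
      · nlinarith
      · have e1 : w / (e + f) * (e + f + 2 * ε) * ((f + ε) * z - y)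
          = (w * ((f + ε) * z - y) / (e + f)) * (e + f + 2 * ε) := by field_simp
        have e2 : e + ε + (f + ε) = e + f + 2 * ε := by ring
        rw [e1, e2]
        gcongr
        rw [le_div_iff₀ hef]
        nlinarith [mul_pos hε h1, mul_pos hw (mul_pos hε h1)]
    have h3 : ftB ω / 6 * (3 * (volume (ftK w e f)).toReal + π - 6 * ω) ≤
      ftB ω / 6 * (3 * (volume (ftK (w / (e + f) * (e + f + 2 * ε)) (e + ε) (f + ε))).toReal + π - 6 * ω) := by
      gcongr
    have e2 : e + ε + (f + ε) = e + f + 2 * ε := by ring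
    rw [e2] at h1
    linarith
  have hlim : Filter.Tendsto (fun ε : ℝ => (w / (e + f) * (e + f + 2 * ε)) * (e + f + 2 * ε) / 3)
      (nhdsWithin 0 (Set.Ioi 0)) (nhds (w * (e + f) / 3)) := by
    have hc : Continuous (fun ε : ℝ => (w / (e + f) * (e + f + 2 * ε)) * (e + f + 2 * ε) / 3) := by fun_prop
    have := (hc.tendsto 0).mono_left (nhdsWithin_le_nhds (s := Set.Ioi 0))
    convert this using 2
    field_simp
    ring
  exact ge_of_tendsto hlim (by filter_upwards [self_mem_nhdsWithin] with ε hε using key ε hε)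

lemma ft_shift (w e f t : ℝ)
    (ht : ∀ y z : ℝ, 0 < z → -e * z ≤ y → 0 ≤ w * (f * z - y) → (y + t * z) ^ 2 ≤ y ^ 2) (hef : 0 < e + f) :
    volume (ftK w e f) ≤ volume (ftK w (e - t) (f + t)) := by
  rw [Measure.volume_eq_prod, Measure.prod_apply_symm (ftK_meas _ _ _), Measure.prod_apply_symm (ftK_meas _ _ _)]
  apply lintegral_mono
  intro z
  simp only
  calc volume ((fun x => (x, z)) ⁻¹' ftK w e f) 
      ≤ volume ((fun q : ℝ × ℝ => q + (0, t * z)) ⁻¹' ((fun x => (x, z)) ⁻¹' ftK w (e - t) (f + t))) := by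
        apply measure_mono
        rintro ⟨x, y⟩ ⟨h1, h2, h3, h4⟩
        simp only at h1 h2 h3 h4
        have h5 := ht y z h1 h2 (le_trans (by positivity) h3)
        refine ⟨h1, ?_, ?_, ?_⟩ <;> simp only [Prod.mk_add_mk, add_zero]
        · linarith
        · have e1 : e - t + (f + t) = e + f := by ring
          have e2 : (f + t) * z - (y + t * z) = f * z - y := by ring
          rw [e1, e2]; exact h3
        · linarith
    _ = _ := by rw [measure_preimage_add_right]

lemma ft_iso'' (ω : ℝ) (hω : ω ∈ Set.Ioo 0 (π / 2)) (w e f : ℝ) (hw : 0 < w) 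
    (hef : 0 < e + f) :
    w * (e + f) / 3 ≥ ftP ω + ftB ω / 6 * (3 * (volume (ftK w e f)).toReal + π - 6 * ω) := by
  have hB := ftB_nonneg ω hω
  have main : ∀ t, 0 ≤ e - t → 0 ≤ f + t → (∀ y z : ℝ, 0 < z → -e * z ≤ y → 0 ≤ w * (f * z - y) → (y + t * z) ^ 2 ≤ y ^ 2) → w * (e + f) / 3 ≥ ftP ω + ftB ω / 6 * (3 * (volume (ftK w e f)).toReal + π - 6 * ω) := by
    intro t h1 h2 h3
    have h4 := ft_iso' ω hω w (e - t) (f + t) hw h1 h2 (by linarith)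
    have h5 := ENNReal.toReal_mono (ftK_fin _ _ _).ne (ft_shift w e f t h3 hef)
    have e1 : e - t + (f + t) = e + f := by ring
    rw [e1] at h4
    have h3 : ftB ω / 6 * (3 * (volume (ftK w e f)).toReal + π - 6 * ω) ≤
      ftB ω / 6 * (3 * (volume (ftK w (e - t) (f + t))).toReal + π - 6 * ω) := by
      gcongr
    linarith
  rcases lt_or_ge e 0 with he | he
  · apply main e (by linarith) (by linarith)
    intro y z hz h1 h2
    have : e * z < 0 := mul_neg_of_neg_of_pos he hz
    nlinarith
  rcases lt_or_ge f 0 with hf | hf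
  · apply main (-f) (by linarith) (by linarith)
    intro y z hz h1 h2
    have h3 : f * z < 0 := mul_neg_of_neg_of_pos hf hz
    have h4 : 0 ≤ f * z - y := nonneg_of_mul_nonneg_right h2 hw
    nlinarith
  · apply main 0 (by linarith) (by linarith)
    intro y z _ _ _
    simp

lemma ft_slice (S K : Set ((ℝ × ℝ) × ℝ)) (hS : MeasurableSet S) (hK : MeasurableSet K)
    (h : ∀ y z : ℝ, volume {x : ℝ | ((x, y), z) ∈ S} ≤ volume {x : ℝ | ((x, y), z) ∈ K}) :
    volume S ≤ volume K := by
  rw [Measure.volume_eq_prod, Measure.prod_apply_symm hS, Measure.prod_apply_symm hK]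
  apply lintegral_mono
  intro z
  simp only
  have m : Measurable (fun x : ℝ × ℝ => (x, z)) := by fun_prop
  rw [Measure.volume_eq_prod, Measure.prod_apply_symm (m hS), Measure.prod_apply_symm (m hK)]
  apply lintegral_mono
  intro y
  exact h y z

lemma ft_tri (ω : ℝ) (hω : ω ∈ Set.Ioo 0 (π / 2)) (x1 x2 x3 y0 y1 h : ℝ) (hx : x1 < x2) (hy : y0 < y1)
    (hh : 0 < h) (S : Set ((ℝ × ℝ) × ℝ)) (hS : MeasurableSet S)
    (hsub : ∀ x y z : ℝ, ((x, y), z) ∈ S → x ^ 2 + y ^ 2 + z ^ 2 ≤ 1 ∧ ∃ a1 a2 a3 : ℝ, 0 < a1 ∧ 0 < a2 ∧ 0 < a3 ∧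
      x = a1 * x1 + a2 * x2 + a3 * x3 ∧ y = a1 * y0 + a2 * y0 + a3 * y1 ∧ z = a1 * h + a2 * h + a3 * h) :
    (x2 - x1) * (y1 - y0) / (6 * h ^ 2) ≥ ftP ω + ftB ω / 6 * (3 * (volume S).toReal + π - 6 * ω) := by
  have hB := ftB_nonneg ω hω
  set w := (x2 - x1) / (2 * h) with hw
  set e := -y0 / h with he
  set f := y1 / h with hf
  have hwp : 0 < w := div_pos (by linarith) (by positivity)
  have hef' : e + f = (y1 - y0) / h := by rw [he, hf]; ring
  have hef : 0 < e + f := by rw [hef']; exact div_pos (by linarith) hh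
  have main := ft_iso'' ω hω w e f hwp hef
  have hle : volume S ≤ volume (ftK w e f) := by
    apply ft_slice _ _ hS (ftK_meas _ _ _)
    intro y z
    by_cases hne : ∃ x, ((x, y), z) ∈ S
    swap
    · have : {x : ℝ | ((x, y), z) ∈ S} = ∅ := by
        ext x; simp only [Set.mem_ofPred_eq, Set.mem_empty_iff_false, iff_false]
        exact fun hx => hne ⟨x, hx⟩
      rw [this]; simp
    obtain ⟨x, hxS⟩ := hne
    obtain ⟨hb, a1, a2, a3, h1, h2, h3, ex, ey, ez⟩ := hsub x y z hxS
    have hz : 0 < z := by rw [ez]; positivity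
    have hey : -e * z ≤ y := by
      have : -e * z = (a1 + a2 + a3) * y0 := by rw [he, ez]; field_simp
      rw [this, ey]
      nlinarith
    set c := 1 - y ^ 2 - z ^ 2 with hc
    have hc0 : 0 ≤ c := by nlinarith [sq_nonneg x]
    -- the parameters
    have hYne : y1 - y0 ≠ 0 := by linarith
    set C := (f * z - y) / (y1 - y0) with hC
    set A := z / h - C with hA
    have ident : ∀ a1 a2 a3 : ℝ, y = a1 * y0 + a2 * y0 + a3 * y1 → z = a1 * h + a2 * h + a3 * h →
        a1 + a2 = C ∧ a3 = A := by
      intro a1 a2 a3 ey ez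
      have : a1 + a2 = C := by
        rw [hC, hf, ey, ez]
        field_simp
        ring
      refine ⟨this, ?_⟩
      rw [hA, ← this, ez]; field_simp; ring
    have hSs : {x : ℝ | ((x, y), z) ∈ S} ⊆ Set.Icc (C * x1 + A * x3) (C * x2 + A * x3) ∩ Set.Icc (-√c) (√c) := by
      intro x' hx'
      obtain ⟨hb, a1, a2, a3, h1, h2, h3, ex, ey, ez⟩ := hsub x' y z hx'
      obtain ⟨i1, i2⟩ := ident a1 a2 a3 ey ez
      refine ⟨⟨?_, ?_⟩, ?_⟩
      · rw [ex, ← i1, ← i2]; nlinarith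
      · rw [ex, ← i1, ← i2]; nlinarith
      · have : |x'| ≤ √c := by
          apply Real.le_sqrt_of_sq_le; rw [sq_abs]; linarith
        exact abs_le.1 this
    have hCnn : 0 ≤ C := by rw [← (ident a1 a2 a3 ey ez).1]; positivity
    set M := min (C * (x2 - x1) / 2) (√c) with hM
    have hM0 : 0 ≤ M := le_min (div_nonneg (mul_nonneg hCnn (by linarith)) (by norm_num)) (sqrt_nonneg _)
    have hKs : Set.Icc (-M) M ⊆ {x : ℝ | ((x, y), z) ∈ ftK w e f} := by
      intro x' hx'
      have hab : |x'| ≤ M := abs_le.2 hx'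
      refine ⟨hz, hey, ?_, ?_⟩ <;> simp only
      · have h1 : |x'| ≤ C * (x2 - x1) / 2 := hab.trans (min_le_left _ _)
        have h2 : w * (f * z - y) = C * (x2 - x1) / 2 * (e + f) := by
          have : f * z - y = C * (y1 - y0) := by rw [hC]; field_simp
          rw [this, hef', hw]; field_simp
        rw [h2]; gcongr
      · have h1 : |x'| ≤ √c := hab.trans (min_le_right _ _)
        have : x' ^ 2 ≤ c := by
          rw [← sq_abs, ← Real.sq_sqrt hc0]; gcongr
        linarith
    refine (measure_mono hSs).trans (le_trans ?_ (measure_mono hKs))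
    rw [Set.Icc_inter_Icc, Real.volume_Icc, Real.volume_Icc]
    apply ENNReal.ofReal_le_ofReal
    rcases min_choice (C * (x2 - x1) / 2) (√c) with hm | hm
    · rw [hM, hm]
      have := min_le_left (C * x2 + A * x3) (√c)
      have := le_max_left (C * x1 + A * x3) (-√c)
      change min (C * x2 + A * x3) (√c) - max (C * x1 + A * x3) (-√c) ≤ _
      linarith
    · rw [hM, hm]
      have := min_le_right (C * x2 + A * x3) (√c)
      have := le_max_right (C * x1 + A * x3) (-√c)
      change min (C * x2 + A * x3) (√c) - max (C * x1 + A * x3) (-√c) ≤ _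
      linarith
  have h5 := ENNReal.toReal_mono (ftK_fin _ _ _).ne hle
  have h3 : ftB ω / 6 * (3 * (volume S).toReal + π - 6 * ω) ≤
      ftB ω / 6 * (3 * (volume (ftK w e f)).toReal + π - 6 * ω) := by
      gcongr
  have e1 : w * (e + f) / 3 = (x2 - x1) * (y1 - y0) / (6 * h ^ 2) := by
    rw [hef', hw]; field_simp; ring
  rw [← e1]
  linarith


lemma ft_tetvol (x1 x2 x3 y0 y1 h : ℝ) (hx : x1 < x2) (hy : y0 < y1)
    (hh : 0 < h) (S : Set ((ℝ × ℝ) × ℝ)) (hS : MeasurableSet S)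
    (hsup : ∀ a1 a2 a3 : ℝ, 0 < a1 → 0 < a2 → 0 < a3 → a1 + a2 + a3 < 1 →
      ((a1 * x1 + a2 * x2 + a3 * x3, a1 * y0 + a2 * y0 + a3 * y1), a1 * h + a2 * h + a3 * h) ∈ S) :
    ENNReal.ofReal ((x2 - x1) * (y1 - y0) * h / 6) ≤ volume S := by
  have hX : 0 < x2 - x1 := by linarith
  have hY : 0 < y1 - y0 := by linarith
  rw [Measure.volume_eq_prod, Measure.prod_apply_symm hS]
  calc ENNReal.ofReal ((x2 - x1) * (y1 - y0) * h / 6) 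
      = ∫⁻ z in Set.Ioc 0 h, ENNReal.ofReal ((x2 - x1) * (y1 - y0) * (z / h) ^ 2 / 2) := by
        have hc : Continuous (fun z : ℝ => (x2 - x1) * (y1 - y0) * (z / h) ^ 2 / 2) := by fun_prop
        rw [← ofReal_integral_eq_lintegral_ofReal]
        · rw [← intervalIntegral.integral_of_le hh.le]
          rw [intervalIntegral.integral_eq_sub_of_hasDerivAt 
            (f := fun z => (x2 - x1) * (y1 - y0) * z ^ 3 / (6 * h ^ 2))]
          · congr 1; field_simp; ring
          · intro z _
            have := (((hasDerivAt_id z).pow 3).const_mul ((x2 - x1) * (y1 - y0))).div_const (6 * h ^ 2)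
            refine this.congr_deriv ?_
            simp; field_simp; ring
          · exact hc.intervalIntegrable _ _
        · exact hc.integrableOn_Icc.mono_set Set.Ioc_subset_Icc_self
        · exact Filter.Eventually.of_forall fun z => by simp only [Pi.zero_apply]; positivity
    _ = ∫⁻ z in Set.Ioo 0 h, ENNReal.ofReal ((x2 - x1) * (y1 - y0) * (z / h) ^ 2 / 2) := by
        rw [Measure.restrict_congr_set Ioo_ae_eq_Ioc]
    _ ≤ ∫⁻ z in Set.Ioo 0 h, volume ((fun x => (x, z)) ⁻¹' S) := by
        apply setLIntegral_mono' measurableSet_Ioo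
        intro z hz
        have m : Measurable (fun x : ℝ × ℝ => (x, z)) := by fun_prop
        rw [Measure.volume_eq_prod, Measure.prod_apply_symm (m hS)]
        set s := z / h with hs
        have hs0 : 0 < s := div_pos hz.1 hh
        have hs1 : s < 1 := (div_lt_one hh).2 hz.2
        have hle : y0 * s ≤ y1 * s := by gcongr
        calc ENNReal.ofReal ((x2 - x1) * (y1 - y0) * s ^ 2 / 2)
            = ∫⁻ y in Set.Ioc (y0 * s) (y1 * s), ENNReal.ofReal ((x2 - x1) * ((y1 * s - y) / (y1 - y0))) := by
              have hc : Continuous (fun y : ℝ => (x2 - x1) * ((y1 * s - y) / (y1 - y0))) := by fun_prop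
              rw [← ofReal_integral_eq_lintegral_ofReal]
              · rw [← intervalIntegral.integral_of_le hle]
                rw [intervalIntegral.integral_eq_sub_of_hasDerivAt 
                  (f := fun y => -(x2 - x1) * (y1 * s - y) ^ 2 / (2 * (y1 - y0)))]
                · congr 1; field_simp; ring
                · intro y _
                  have := (((((hasDerivAt_id y).const_sub (y1 * s)).pow 2).const_mul (-(x2 - x1))).div_const (2 * (y1 - y0)))
                  refine this.congr_deriv ?_
                  simp; field_simp; ring
                · exact hc.intervalIntegrable _ _
              · exact hc.integrableOn_Icc.mono_set Set.Ioc_subset_Icc_self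
              · filter_upwards [self_mem_ae_restrict measurableSet_Ioc] with y hy
                have : 0 ≤ y1 * s - y := by linarith [hy.2]
                simp only [Pi.zero_apply]; positivity
          _ = ∫⁻ y in Set.Ioo (y0 * s) (y1 * s), ENNReal.ofReal ((x2 - x1) * ((y1 * s - y) / (y1 - y0))) := by
              rw [Measure.restrict_congr_set Ioo_ae_eq_Ioc]
          _ ≤ ∫⁻ y in Set.Ioo (y0 * s) (y1 * s), volume ((fun x => (x, y)) ⁻¹' ((fun x => (x, z)) ⁻¹' S)) := by
              apply setLIntegral_mono' measurableSet_Ioo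
              intro y hy
              set C := (y1 * s - y) / (y1 - y0) with hC
              set A := (y - y0 * s) / (y1 - y0) with hA
              have hCp : 0 < C := div_pos (by linarith [hy.2]) hY
              have hAp : 0 < A := div_pos (by linarith [hy.1]) hY
              have hCA : C + A = s := by rw [hC, hA]; field_simp; ring
              have hCA2 : C * y0 + A * y1 = y := by rw [hC, hA]; field_simp; ring
              have : ENNReal.ofReal ((x2 - x1) * C) = volume (Set.Ioo (C * x1 + A * x3) (C * x2 + A * x3)) := by
                rw [Real.volume_Ioo]; congr 1; ring
              rw [this]
              apply measure_mono
              intro x hx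
              set a2 := (x - (C * x1 + A * x3)) / (x2 - x1) with ha2
              have ha2p : 0 < a2 := div_pos (by linarith [hx.1]) hX
              have ha2X : a2 * (x2 - x1) = x - (C * x1 + A * x3) := by rw [ha2]; field_simp
              have ha1p : 0 < C - a2 := by
                rw [sub_pos, ha2, div_lt_iff₀ hX]; nlinarith [hx.2]
              have := hsup (C - a2) a2 A ha1p ha2p hAp (by linarith)
              have e1 : (C - a2) * x1 + a2 * x2 + A * x3 = x := by linarith
              have e2 : (C - a2) * y0 + a2 * y0 + A * y1 = y := by linarith
              have e3 : (C - a2) * h + a2 * h + A * h = z := by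
                have : z = s * h := by rw [hs]; field_simp
                rw [this, ← hCA]; ring
              rw [e1, e2, e3] at this
              exact this
          _ ≤ _ := setLIntegral_le_lintegral _ _
    _ ≤ _ := setLIntegral_le_lintegral _ _

abbrev E3 := EuclideanSpace ℝ (Fin 3)

def ftCoord : E3 → (ℝ × ℝ) × ℝ := fun x => ((x 0, x 1), x 2)

lemma ftCoord_mp : MeasurePreserving ftCoord volume volume := by
  have h1 := PiLp.volume_preserving_ofLp (Fin 3)
  have h2 := volume_preserving_piFinSuccAbove (fun _ : Fin 3 => ℝ) 2
  have h3 := volume_preserving_piFinTwo (fun _ : Fin 2 => ℝ)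
  have h4 : MeasurePreserving (Prod.swap : ℝ × (Fin 2 → ℝ) → (Fin 2 → ℝ) × ℝ) volume volume :=
    Measure.measurePreserving_swap
  have h5 : MeasurePreserving (Prod.map (MeasurableEquiv.piFinTwo (fun _ : Fin 2 => ℝ)) (id : ℝ → ℝ)) volume volume :=
    MeasurePreserving.prod h3 (MeasurePreserving.id _)
  exact h5.comp (h4.comp (h2.comp h1))

/-- open cone -/
def ftCone (v : Fin 3 → E3) : Set E3 := {x | ∃ a : Fin 3 → ℝ, (∀ i, 0 < a i) ∧ x = ∑ i, a i • v i}
/-- open tetrahedron -/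
def ftTet (v : Fin 3 → E3) : Set E3 :=
  {x | ∃ a : Fin 3 → ℝ, (∀ i, 0 < a i) ∧ ∑ i, a i < 1 ∧ x = ∑ i, a i • v i}

lemma ft_coords (v : Fin 3 → E3) (hv : LinearIndependent ℝ v) (y : E3) (hy : ∀ i, inner ℝ (v i) y = 1) :
    ∃ (b : OrthonormalBasis (Fin 3) ℝ E3) (x1 x2 x3 y0 y1 : ℝ), x1 < x2 ∧ y0 < y1 ∧
      b.repr (v 0) 0 = x1 ∧ b.repr (v 1) 0 = x2 ∧ b.repr (v 2) 0 = x3 ∧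
      b.repr (v 0) 1 = y0 ∧ b.repr (v 1) 1 = y0 ∧ b.repr (v 2) 1 = y1 ∧
      (∀ i, b.repr (v i) 2 = 1 / ‖y‖) := by
  have hy0 : y ≠ 0 := by
    rintro rfl
    have := hy 0
    simp at this
  have hyn : 0 < ‖y‖ := norm_pos_iff.2 hy0
  set p := v 1 - v 0 with hp
  set q := v 2 - v 0 with hq
  have hp0 : p ≠ 0 := by
    intro h
    have h01 : v 1 = v 0 := sub_eq_zero.1 h
    have := hv.injective h01
    simp at this
  have hpn : 0 < ‖p‖ := norm_pos_iff.2 hp0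
  set k := inner ℝ p q / ‖p‖ ^ 2 with hk
  set u := q - k • p with hu
  have hu0 : u ≠ 0 := by
    intro h
    rw [Fintype.linearIndependent_iff] at hv
    have := hv ![k - 1, -k, 1] (by
      rw [Fin.sum_univ_three]
      simp only [Matrix.cons_val_zero, Matrix.cons_val_one, Matrix.cons_val_two, Matrix.head_cons, Matrix.tail_cons, Matrix.cons_val]
      rw [← h, hu, hq, hp]
      module) 2
    simp at this
  have hun : 0 < ‖u‖ := norm_pos_iff.2 hu0
  have hpy : inner ℝ p y = 0 := by rw [hp, inner_sub_left, hy, hy, sub_self]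
  have hqy : inner ℝ q y = 0 := by rw [hq, inner_sub_left, hy, hy, sub_self]
  have huy : inner ℝ u y = 0 := by rw [hu, inner_sub_left, inner_smul_left, hqy, hpy]; simp
  have hpu : inner ℝ p u = 0 := by
    rw [hu, inner_sub_right, inner_smul_right, hk, real_inner_self_eq_norm_sq]; field_simp; ring
  let B : Fin 3 → E3 := ![‖p‖⁻¹ • p, ‖u‖⁻¹ • u, ‖y‖⁻¹ • y]
  have hon : Orthonormal ℝ B := by
    constructor
    · intro i; fin_cases i <;> simp [B, norm_smul, hp0, hu0, hy0]
    · intro i j hij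
      fin_cases i <;> fin_cases j <;> first | exact absurd rfl hij | skip
      all_goals simp [B, inner_smul_left, inner_smul_right, hpu, hpy, huy, real_inner_comm p u, real_inner_comm p y, real_inner_comm u y]
      all_goals (first | (rw [real_inner_comm]; simp [hpu, hpy, huy]))
  have hspan : ⊤ ≤ Submodule.span ℝ (Set.range B) := by
    rw [hon.linearIndependent.span_eq_top_of_card_eq_finrank']
    simp
  let b := OrthonormalBasis.mk hon hspan
  have hb : ∀ i, b i = B i := fun i => by simp [b]
  have rep : ∀ x i, b.repr x i = inner ℝ (B i) x := fun x i => by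
    rw [OrthonormalBasis.repr_apply_apply, hb]
  refine ⟨b, b.repr (v 0) 0, b.repr (v 1) 0, b.repr (v 2) 0, b.repr (v 0) 1, b.repr (v 2) 1, ?_, ?_, rfl, rfl, rfl, rfl, ?_, rfl, ?_⟩
  · rw [← sub_pos, rep, rep, ← inner_sub_right, ← hp]
    simp only [B, Matrix.cons_val_zero, inner_smul_left]
    rw [real_inner_self_eq_norm_sq]
    simp; positivity
  · rw [← sub_pos, rep, rep, ← inner_sub_right, ← hq]
    have : q = u + k • p := by rw [hu]; abel
    rw [this]
    simp only [B, Matrix.cons_val_one, Matrix.cons_val_zero, inner_smul_left, inner_add_right, inner_smul_right]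
    rw [real_inner_self_eq_norm_sq, real_inner_comm, hpu]
    simp; positivity
  · rw [← sub_eq_zero, rep, rep, ← inner_sub_right, ← hp]
    simp only [B, Matrix.cons_val_one, Matrix.cons_val_zero, inner_smul_left]
    rw [real_inner_comm, hpu]; simp
  · intro i
    rw [rep]
    simp only [B, Matrix.cons_val, inner_smul_left]
    rw [real_inner_comm, hy]; simp

lemma ftCone_eq (v : Fin 3 → E3) (hv : LinearIndependent ℝ v) :
    ∃ φ : E3 ≃ₗ[ℝ] (Fin 3 → ℝ), (∀ i, φ (v i) = Pi.single i 1) ∧ ftCone v = {x | ∀ i, 0 < φ x i} ∧ 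
     ftTet v = {x | (∀ i, 0 < φ x i) ∧ ∑ i, φ x i < 1} ∧ ∀ x, x = ∑ i, φ x i • v i := by
  let bb := basisOfLinearIndependentOfCardEqFinrank hv (by simp)
  have hb : ∀ i, bb i = v i := fun i => by simp [bb]
  have hsum : ∀ x, x = ∑ i, bb.equivFun x i • v i := by
    intro x
    conv_lhs => rw [← bb.sum_equivFun x]
    simp [hb]
  have hinv : ∀ a : Fin 3 → ℝ, bb.equivFun (∑ i, a i • v i) = a := by
    intro a
    have : ∑ i, a i • v i = bb.equivFun.symm a := by
      rw [bb.equivFun_symm_apply]; simp [hb]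
    rw [this, LinearEquiv.apply_symm_apply]
  refine ⟨bb.equivFun, ?_, ?_, ?_, hsum⟩
  · intro i
    rw [← hb]; simp [Pi.single_apply, Finsupp.single_apply, funext_iff, eq_comm]
  · ext x
    constructor
    · rintro ⟨a, ha, rfl⟩ i
      rw [hinv]; exact ha i
    · intro h
      exact ⟨_, h, hsum x⟩
  · ext x
    constructor
    · rintro ⟨a, ha, h1, rfl⟩
      refine ⟨fun i => ?_, ?_⟩
      · rw [hinv]; exact ha i
      · rw [hinv]; exact h1
    · intro h
      exact ⟨_, h.1, h.2, hsum x⟩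

lemma ftCone_meas (v : Fin 3 → E3) (hv : LinearIndependent ℝ v) : MeasurableSet (ftCone v) := by
  obtain ⟨φ, _, h, _⟩ := ftCone_eq v hv
  rw [h]
  have hc : Continuous φ := φ.toLinearMap.continuous_of_finiteDimensional
  rw [Set.ofPred_forall]
  exact MeasurableSet.iInter fun i => 
    (isOpen_lt continuous_const ((continuous_apply i).comp hc)).measurableSet

lemma ftTet_meas (v : Fin 3 → E3) (hv : LinearIndependent ℝ v) : MeasurableSet (ftTet v) := by
  obtain ⟨φ, _, h1, h, _⟩ := ftCone_eq v hv
  have hc : Continuous φ := φ.toLinearMap.continuous_of_finiteDimensional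
  have : ftTet v = ftCone v ∩ {x | ∑ i, φ x i < 1} := by rw [h, h1]; rfl
  rw [this]
  exact (ftCone_meas v hv).inter (isOpen_lt (continuous_finsetSum _ fun i _ => (continuous_apply i).comp hc) continuous_const).measurableSet

lemma ftTet_fin (v : Fin 3 → E3) : volume (ftTet v) < ⊤ := by
  apply Bornology.IsBounded.measure_lt_top
  rw [isBounded_iff_forall_norm_le]
  refine ⟨∑ i, ‖v i‖, ?_⟩
  rintro x ⟨a, ha, h1, rfl⟩
  refine (norm_sum_le _ _).trans (Finset.sum_le_sum fun i hi => ?_)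
  rw [norm_smul, Real.norm_of_nonneg (ha i).le]
  have : a i ≤ ∑ i, a i := Finset.single_le_sum (fun i _ => (ha i).le) hi
  exact mul_le_of_le_one_left (norm_nonneg _) (by linarith)

lemma ft_local (ω : ℝ) (hω : ω ∈ Set.Ioo 0 (π / 2)) (v : Fin 3 → E3) (hv : LinearIndependent ℝ v) (y : E3)
    (hy : ∀ i, inner ℝ (v i) y = 1) (r : ℝ) (hr : 0 < r) (hry : r * ‖y‖ ≤ 1) :
    (volume (ftTet v)).toReal ≥ r ^ 3 * (ftP ω + ftB ω / 6 *
      (3 * (volume (ftCone v ∩ Metric.closedBall 0 1)).toReal + π - 6 * ω)) := by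
  obtain ⟨b, x1, x2, x3, y0, y1, hx, hyy, hx1, hx2, hx3, hy1, hy2, hy3, hz⟩ := ft_coords v hv y hy
  have hy0 : y ≠ 0 := by
    rintro rfl
    have := hy 0
    simp at this
  have hyn : 0 < ‖y‖ := norm_pos_iff.2 hy0
  set h := 1 / ‖y‖ with hh
  have hhp : 0 < h := by positivity
  have hrh : r ≤ h := by rw [hh, le_div_iff₀ hyn]; exact hry
  let Θ : E3 → (ℝ × ℝ) × ℝ := fun x => ftCoord (b.repr x)
  have hΘ : MeasurePreserving Θ volume volume := ftCoord_mp.comp b.measurePreserving_repr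
  -- inverse
  let e : E3 ≃ᵐ (ℝ × ℝ) × ℝ := 
    { toFun := Θ
      invFun := fun p => b.repr.symm (WithLp.toLp 2 ![p.1.1, p.1.2, p.2])
      left_inv := by
        intro x
        simp only [Θ, ftCoord]
        rw [LinearIsometryEquiv.symm_apply_eq]
        ext i; fin_cases i <;> simp
      right_inv := by
        intro p
        simp [Θ, ftCoord]
      measurable_toFun := hΘ.measurable
      measurable_invFun := by
        apply b.repr.symm.continuous.measurable.comp
        apply (PiLp.continuous_toLp 2 _).measurable.comp
        rw [measurable_pi_iff]
        intro i; fin_cases i <;> simp <;> fun_prop }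
  have he : MeasurePreserving e.symm volume volume := by
    have : MeasurePreserving e volume volume := hΘ
    exact this.symm
  have hco : ∀ a : Fin 3 → ℝ, Θ (∑ i, a i • v i) = ((a 0 * x1 + a 1 * x2 + a 2 * x3, a 0 * y0 + a 1 * y0 + a 2 * y1), a 0 * h + a 1 * h + a 2 * h) := by
    intro a
    simp only [Θ, ftCoord, Fin.sum_univ_three, map_add, map_smul, PiLp.add_apply, PiLp.smul_apply, smul_eq_mul, hx1, hx2, hx3, hy1, hy2, hy3, hz]
  have hCm : MeasurableSet (ftCone v ∩ Metric.closedBall 0 1) := (ftCone_meas v hv).inter Metric.isClosed_closedBall.measurableSet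
  have k1 : volume (ftCone v ∩ Metric.closedBall 0 1) = volume (e.symm ⁻¹' (ftCone v ∩ Metric.closedBall 0 1)) :=
    (he.measure_preimage hCm.nullMeasurableSet).symm
  have k2 : volume (ftTet v) = volume (e.symm ⁻¹' (ftTet v)) :=
    (he.measure_preimage (ftTet_meas v hv).nullMeasurableSet).symm
  have t1 := ft_tri ω hω x1 x2 x3 y0 y1 h hx hyy hhp _ (e.symm.measurable hCm) (by
    intro x yy z hm
    obtain ⟨⟨a, ha, hxa⟩, hb⟩ := hm
    have hval : Θ (e.symm ((x, yy), z)) = ((x, yy), z) := e.apply_symm_apply _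
    constructor
    · rw [mem_closedBall_zero_iff] at hb
      set X := e.symm ((x, yy), z) with hX
      have hn : ‖b.repr X‖ = ‖X‖ := b.repr.norm_map X
      have hns := EuclideanSpace.norm_sq_eq (b.repr X)
      rw [hn, Fin.sum_univ_three] at hns
      simp only [Θ, ftCoord, Prod.mk.injEq] at hval
      obtain ⟨⟨v1, v2⟩, v3⟩ := hval
      rw [v1, v2, v3] at hns
      simp only [Real.norm_eq_abs, sq_abs] at hns
      rw [← hns]
      exact pow_le_one₀ (norm_nonneg _) hb
    · rw [hxa, hco] at hval
      simp only [Prod.mk.injEq] at hval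
      obtain ⟨⟨v1, v2⟩, v3⟩ := hval
      exact ⟨a 0, a 1, a 2, ha 0, ha 1, ha 2, v1.symm, v2.symm, v3.symm⟩)
  rw [← k1] at t1
  have t2 := ft_tetvol x1 x2 x3 y0 y1 h hx hyy hhp _ (e.symm.measurable (ftTet_meas v hv)) (by
    intro a1 a2 a3 h1 h2 h3 hs
    have : Θ (∑ i, ![a1, a2, a3] i • v i) = _ := hco ![a1, a2, a3]
    simp only [Matrix.cons_val_zero, Matrix.cons_val_one, Matrix.cons_val] at this
    rw [← this]
    rw [Set.mem_preimage]
    have : e.symm (Θ (∑ i, ![a1, a2, a3] i • v i)) = ∑ i, ![a1, a2, a3] i • v i := e.symm_apply_apply _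
    rw [this]
    refine ⟨_, ?_, ?_, rfl⟩
    · intro i; fin_cases i <;> simpa
    · simpa [Fin.sum_univ_three] using hs)
  rw [← k2] at t2
  have hX : 0 < x2 - x1 := by linarith
  have hY : 0 < y1 - y0 := by linarith
  have t3 : (x2 - x1) * (y1 - y0) * h / 6 ≤ (volume (ftTet v)).toReal :=
    (ENNReal.ofReal_le_iff_le_toReal (ftTet_fin v).ne).1 t2
  have e1 : (x2 - x1) * (y1 - y0) * h / 6 = h ^ 3 * ((x2 - x1) * (y1 - y0) / (6 * h ^ 2)) := by
    field_simp
  rw [e1] at t3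
  have t4 : r ^ 3 * ((x2 - x1) * (y1 - y0) / (6 * h ^ 2)) ≤ h ^ 3 * ((x2 - x1) * (y1 - y0) / (6 * h ^ 2)) := by
    gcongr
  have t5 := mul_le_mul_of_nonneg_left t1 (by positivity : 0 ≤ r ^ 3)
  linarith


def ftW (v : Fin 3 → E3) (k : Fin 3) : Set E3 :=
  {x | ∃ a : Fin 3 → ℝ, (∀ i, i ≠ k → 0 < a i) ∧ x = ∑ i, a i • v i}

noncomputable def ftMu : Measure E3 := volume.restrict (Metric.closedBall 0 1)

instance : IsFiniteMeasure ftMu := by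
  unfold ftMu
  have : Fact (volume (Metric.closedBall (0:E3) 1) < ⊤) := ⟨measure_closedBall_lt_top⟩
  infer_instance

lemma ftMu_neg (S : Set E3) (hS : MeasurableSet S) : ftMu.real (Neg.neg ⁻¹' S) = ftMu.real S := by
  unfold ftMu
  rw [measureReal_restrict_apply hS, measureReal_restrict_apply (measurable_neg hS)]
  have : Neg.neg ⁻¹' S ∩ Metric.closedBall (0:E3) 1 = Neg.neg ⁻¹' (S ∩ Metric.closedBall (0:E3) 1) := by
    ext x; simp
  rw [this, measureReal_def, measureReal_def, Measure.measure_preimage_neg]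

lemma ftMu_null (s : Submodule ℝ E3) (hs : s ≠ ⊤) : ftMu (s : Set E3) = 0 := by
  refine le_antisymm ?_ (zero_le)
  refine (Measure.restrict_apply_le _ _).trans ?_
  rw [Measure.addHaar_submodule _ _ hs]

lemma ftW_eq (v : Fin 3 → E3) (φ : E3 ≃ₗ[ℝ] (Fin 3 → ℝ)) (h1 : ∀ i, φ (v i) = Pi.single i 1)
    (h2 : ∀ x, x = ∑ i, φ x i • v i) (k : Fin 3) : ftW v k = {x | ∀ i, i ≠ k → 0 < φ x i} := by
  ext x
  constructor
  · rintro ⟨a, ha, rfl⟩ i hi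
    have : φ (∑ i, a i • v i) i = a i := by
      rw [map_sum, Finset.sum_apply]
      simp [h1, Pi.single_apply]
    rw [this]; exact ha i hi
  · intro h
    exact ⟨_, h, h2 x⟩

lemma ftW_meas (v : Fin 3 → E3) (hv : LinearIndependent ℝ v) (k : Fin 3) : MeasurableSet (ftW v k) := by
  obtain ⟨φ, h1, _, _, h2⟩ := ftCone_eq v hv
  rw [ftW_eq v φ h1 h2]
  have hc : Continuous φ := φ.toLinearMap.continuous_of_finiteDimensional
  have : {x | ∀ i, i ≠ k → 0 < φ x i} = ⋂ i, ⋂ (_ : i ≠ k), {x | 0 < φ x i} := by ext; simp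
  rw [this]
  exact MeasurableSet.iInter fun i => MeasurableSet.iInter fun _ => 
    (isOpen_lt continuous_const ((continuous_apply i).comp hc)).measurableSet

lemma ft_girard (v : Fin 3 → E3) (hv : LinearIndependent ℝ v) :
    2 * ftMu.real (ftCone v) = ∑ k, ftMu.real (ftW v k) - ftMu.real Set.univ / 2 := by
  obtain ⟨φ, h1, hC, _, h2⟩ := ftCone_eq v hv
  have hc : Continuous φ := φ.toLinearMap.continuous_of_finiteDimensional
  have mP : ∀ i, MeasurableSet {x | 0 < φ x i} := fun i =>
    (isOpen_lt continuous_const ((continuous_apply i).comp hc)).measurableSet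
  have hz : ∀ i, ∀ᵐ x ∂ftMu, φ x i ≠ 0 := by
    intro i
    rw [ae_iff]
    have := ftMu_null (LinearMap.ker ((LinearMap.proj i).comp φ.toLinearMap)) ?_
    · convert this using 2
      ext x; simp
    · intro h
      have : v i ∈ LinearMap.ker ((LinearMap.proj i).comp φ.toLinearMap) := by rw [h]; trivial
      simp [h1] at this
  set H : Fin 3 → Set E3 := fun i => {x | 0 < φ x i} with hH
  have e0 : ftW v 0 = H 1 ∩ H 2 := by
    rw [ftW_eq v φ h1 h2]; ext x; simp [Fin.forall_fin_succ, hH]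
  have e1 : ftW v 1 = H 0 ∩ H 2 := by
    rw [ftW_eq v φ h1 h2]; ext x; simp [Fin.forall_fin_succ, hH]
  have e2 : ftW v 2 = H 0 ∩ H 1 := by
    rw [ftW_eq v φ h1 h2]; ext x; simp [Fin.forall_fin_succ, hH]
  have eC : ftCone v = H 0 ∩ H 1 ∩ H 2 := by
    rw [hC]; ext x; simp [Fin.forall_fin_succ, hH, and_assoc]
  rw [Fin.sum_univ_three, e0, e1, e2, eC]
  have q0 := measureReal_inter_add_sdiff (μ := ftMu) (s := (H 1 ∩ H 2)) (mP 0)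
  have q1 := measureReal_inter_add_sdiff (μ := ftMu) (s := (H 0 ∩ H 2)) (mP 1)
  have q2 := measureReal_inter_add_sdiff (μ := ftMu) (s := (H 0 ∩ H 1)) (mP 2)
  have q3 := measureReal_inter_add_sdiff (μ := ftMu) (s := (H 0)) (mP 1)
  have q4 := measureReal_inter_add_sdiff (μ := ftMu) (s := (H 0 \ H 1)) (mP 2)
  have q5 := measureReal_inter_add_sdiff (μ := ftMu) (s := Set.univ) (mP 0)
  have n1 : ftMu.real (Set.univ \ H 0) = ftMu.real (H 0) := by
    rw [← ftMu_neg (H 0) (mP 0)]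
    apply measureReal_congr
    filter_upwards [hz 0] with x hx
    apply propext
    change (True ∧ ¬ (0 < φ x 0)) ↔ 0 < φ (-x) 0
    simp only [map_neg, Pi.neg_apply, true_and]
    constructor
    · intro h; have := lt_of_le_of_ne (not_lt.1 h) hx; linarith
    · intro h; linarith
  have n2 : ftMu.real ((H 0 \ H 1) \ H 2) = ftMu.real ((H 1 ∩ H 2) \ H 0) := by
    rw [← ftMu_neg ((H 1 ∩ H 2) \ H 0) (((mP 1).inter (mP 2)).diff (mP 0))]
    apply measureReal_congr
    filter_upwards [hz 0, hz 1, hz 2] with x hx0 hx1 hx2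
    apply propext
    change ((0 < φ x 0 ∧ ¬ (0 < φ x 1)) ∧ ¬ (0 < φ x 2)) ↔ ((0 < φ (-x) 1 ∧ 0 < φ (-x) 2) ∧ ¬ (0 < φ (-x) 0))
    simp only [map_neg, Pi.neg_apply]
    constructor
    · rintro ⟨⟨a, b⟩, c⟩
      have := lt_of_le_of_ne (not_lt.1 b) hx1
      have := lt_of_le_of_ne (not_lt.1 c) hx2
      refine ⟨⟨?_, ?_⟩, ?_⟩ <;> linarith
    · rintro ⟨⟨a, b⟩, c⟩
      have : 0 ≤ φ x 0 := by linarith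
      have := lt_of_le_of_ne this hx0.symm
      refine ⟨⟨?_, ?_⟩, ?_⟩ <;> linarith
  have s0 : H 1 ∩ H 2 ∩ H 0 = H 0 ∩ H 1 ∩ H 2 := by ext; simp; tauto
  have s1 : H 0 ∩ H 2 ∩ H 1 = H 0 ∩ H 1 ∩ H 2 := by ext; simp; tauto
  have s2 : (H 0 \ H 1) ∩ H 2 = (H 0 ∩ H 2) \ H 1 := by ext; simp; tauto
  rw [Set.univ_inter] at q5
  rw [s0] at q0
  rw [s1] at q1
  rw [s2] at q4
  linarith

section
variable {n : ℕ}

def ftFace (v : Fin n → E3) (T : Fin 3 → Fin n) (y : E3) : Prop :=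
  StrictMono T ∧ LinearIndependent ℝ (v ∘ T) ∧ (∀ i, inner ℝ (v (T i)) y = 1) ∧
    ∀ j, j ∉ Set.range T → inner ℝ (v j) y < 1

lemma ft_range_inj (T T' : Fin 3 → Fin n) (h : StrictMono T) (h' : StrictMono T')
    (hs : Set.range T ⊆ Set.range T') : T = T' := by
  rw [← StrictMono.range_inj h h']
  apply Set.eq_of_subset_of_ncard_le hs
  rw [← Set.image_univ, ← Set.image_univ, Set.ncard_image_of_injective _ h.injective,
    Set.ncard_image_of_injective _ h'.injective]

lemma ft_face_lt (v : Fin n → E3) (T T' : Fin 3 → Fin n) (y y' : E3) (h : ftFace v T y)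
    (h' : ftFace v T' y') (hne : T ≠ T') (a : Fin 3 → ℝ) (ha : ∀ i, 0 < a i) :
    inner ℝ (∑ i, a i • (v ∘ T) i) y' < inner ℝ (∑ i, a i • (v ∘ T) i) y := by
  rw [sum_inner, sum_inner]
  have hle : ∀ j, inner ℝ (v j) y' ≤ 1 := by
    intro j
    by_cases hj : j ∈ Set.range T'
    · obtain ⟨i, rfl⟩ := hj
      exact (h'.2.2.1 i).le
    · exact (h'.2.2.2 j hj).le
  have : ¬ Set.range T ⊆ Set.range T' := fun hs => hne (ft_range_inj T T' h.1 h'.1 hs)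
  rw [Set.not_subset] at this
  obtain ⟨_, ⟨k, rfl⟩, hk⟩ := this
  apply Finset.sum_lt_sum
  · intro i _
    rw [inner_smul_left, inner_smul_left]
    have := hle (T i)
    have h1 := h.2.2.1 i
    simp only [Function.comp, h1]
    exact mul_le_mul_of_nonneg_left this (ha i).le
  · refine ⟨k, Finset.mem_univ _, ?_⟩
    rw [inner_smul_left, inner_smul_left]
    have := h'.2.2.2 (T k) hk
    have h1 := h.2.2.1 k
    simp only [Function.comp, h1]
    exact mul_lt_mul_of_pos_left this (ha k)

lemma ft_cone_disj (v : Fin n → E3) (T T' : Fin 3 → Fin n) (y y' : E3) (h : ftFace v T y)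
    (h' : ftFace v T' y') (hne : T ≠ T') : Disjoint (ftCone (v ∘ T)) (ftCone (v ∘ T')) := by
  rw [Set.disjoint_left]
  rintro x ⟨a, ha, hx⟩ ⟨a', ha', hx'⟩
  have h1 := ft_face_lt v T T' y y' h h' hne a ha
  have h2 := ft_face_lt v T' T y' y h' h hne.symm a' ha'
  rw [← hx] at h1
  rw [← hx'] at h2
  linarith

lemma ft_wedge_shift (v : Fin 3 → E3) (k : Fin 3) (a : Fin 3 → ℝ) (ha : ∀ i, i ≠ k → 0 < a i) 
    (ε : ℝ) (hε : 0 < ε) (h : ε * |a k| < 1) : v k + ε • ∑ i, a i • v i ∈ ftCone v := by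
  refine ⟨fun i => (if i = k then 1 else 0) + ε * a i, ?_, ?_⟩
  · intro i
    by_cases hi : i = k
    · subst hi
      have := neg_abs_le (a i)
      simp only [if_true]
      nlinarith
    · have := ha i hi
      simp only [hi, if_false]
      positivity
  · simp only [add_smul, Finset.sum_add_distrib, Finset.smul_sum, smul_smul, ite_smul, one_smul, zero_smul]
    simp

lemma ft_wedge_disj (v : Fin n → E3) (T T' : Fin 3 → Fin n) (y y' : E3) (h : ftFace v T y)
    (h' : ftFace v T' y') (hne : T ≠ T') (k k' : Fin 3) (hk : T k = T' k') :
    Disjoint (ftW (v ∘ T) k) (ftW (v ∘ T') k') := by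
  rw [Set.disjoint_left]
  rintro x ⟨a, ha, hx⟩ ⟨a', ha', hx'⟩
  have hd := ft_cone_disj v T T' y y' h h' hne
  set ε := 1 / (1 + |a k| + |a' k'|) with hε
  have hε0 : 0 < ε := by positivity
  have b1 : ε * |a k| < 1 := by
    rw [hε, one_div_mul_eq_div, div_lt_one (by positivity)]
    have := abs_nonneg (a' k'); linarith
  have b2 : ε * |a' k'| < 1 := by
    rw [hε, one_div_mul_eq_div, div_lt_one (by positivity)]
    have := abs_nonneg (a k); linarith
  have c1 := ft_wedge_shift (v ∘ T) k a ha ε hε0 b1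
  have c2 := ft_wedge_shift (v ∘ T') k' a' ha' ε hε0 b2
  rw [← hx] at c1
  rw [← hx'] at c2
  have : (v ∘ T') k' = (v ∘ T) k := by simp [hk]
  rw [this] at c2
  exact Set.disjoint_left.1 hd c1 c2

end


lemma ft_hull {n : ℕ} (v : Fin n → E3) (x : E3) (hx : x ∈ convexHull ℝ (Set.range v)) :
    ∃ w : Fin n → ℝ, (∀ i, 0 ≤ w i) ∧ ∑ i, w i = 1 ∧ x = ∑ i, w i • v i := by
  have : convexHull ℝ (Set.range v) ⊆ (Fintype.linearCombination ℝ v) '' stdSimplex ℝ (Fin n) := by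
    apply convexHull_min
    · rintro _ ⟨i, rfl⟩
      refine ⟨Pi.single i 1, single_mem_stdSimplex ℝ i, ?_⟩
      simp [Fintype.linearCombination_apply, Pi.single_apply]
    · exact (convex_stdSimplex ℝ _).linear_image _
  obtain ⟨w, hw, rfl⟩ := this hx
  exact ⟨w, hw.1, hw.2, by simp [Fintype.linearCombination_apply]⟩

lemma ft_support (K : Set E3) (hK : Convex ℝ K) (hc : IsCompact K) (r : ℝ) (hr : 0 < r)
    (hb : Metric.closedBall 0 r ⊆ K) (x : E3) (hx : x ≠ 0) :
    ∃ (t : ℝ) (y : E3), 0 < t ∧ t • x ∈ K ∧ inner ℝ (t • x) y = 1 ∧ ∀ z ∈ K, inner ℝ z y ≤ 1 := by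
  have h0 : K ∈ nhds (0:E3) := Filter.mem_of_superset (Metric.closedBall_mem_nhds _ hr) hb
  have hg : 0 < gauge K x := (gauge_pos (absorbent_nhds_zero h0) 
    ((NormedSpace.isVonNBounded_iff ℝ).2 hc.isBounded)).2 hx
  set t := (gauge K x)⁻¹ with ht
  have ht0 : 0 < t := inv_pos.2 hg
  have hf : t • x ∈ frontier K := by
    rw [← gauge_eq_one_iff_mem_frontier hK h0, gauge_smul_of_nonneg ht0.le, smul_eq_mul, ht]
    field_simp
  have hin : t • x ∈ K := by
    have := frontier_subset_closure hf
    rwa [hc.isClosed.closure_eq] at this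
  obtain ⟨f, hf'⟩ := geometric_hahn_banach_open_point hK.interior isOpen_interior hf.2
  have hp : 0 < f (t • x) := by
    have := hf' 0 (mem_interior_iff_mem_nhds.2 h0)
    simpa using this
  have hle : ∀ z ∈ K, f z ≤ f (t • x) := by
    have h1 : closure (interior K) ⊆ {z | f z ≤ f (t • x)} := 
      closure_minimal (fun z hz => (hf' z hz).le) (isClosed_le f.continuous continuous_const)
    rw [hK.closure_interior_eq_closure_of_nonempty_interior ⟨0, mem_interior_iff_mem_nhds.2 h0⟩] at h1
    exact fun z hz => h1 (subset_closure hz)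
  have hin' : ∀ z, inner ℝ z ((f (t • x))⁻¹ • (InnerProductSpace.toDual ℝ E3).symm f) = (f (t • x))⁻¹ * f z := by
    intro z
    rw [inner_smul_right, real_inner_comm, InnerProductSpace.toDual_symm_apply]
  refine ⟨t, (f (t • x))⁻¹ • (InnerProductSpace.toDual ℝ E3).symm f, ht0, hin, ?_, ?_⟩
  · rw [hin', inv_mul_cancel₀ hp.ne']
  · intro z hz
    rw [hin', inv_mul_le_one₀ hp]
    exact hle z hz

def ftGen {n : ℕ} (v : Fin n → E3) : Prop :=
  ∀ (S : Finset (Fin n)) (y : E3), (∀ i ∈ S, inner ℝ (v i) y = 1) → S.card ≤ 3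

lemma ft_cover {n : ℕ} (v : Fin n → E3) (hg : ftGen v) (r : ℝ) (hr : 0 < r)
    (hb : Metric.closedBall 0 r ⊆ convexHull ℝ (Set.range v)) (x : E3)
    (hx : ∀ S : Finset (Fin n), S.card ≤ 2 → x ∉ Submodule.span ℝ (v '' S)) :
    ∃ T y, ftFace v T y ∧ x ∈ ftCone (v ∘ T) := by
  have hx0 : x ≠ 0 := by
    rintro rfl
    exact hx ∅ (by simp) (Submodule.zero_mem _)
  obtain ⟨t, y, ht, hxK, hxy, hle⟩ := ft_support _ (convex_convexHull ℝ _) 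
    ((Set.finite_range v).isCompact_convexHull (𝕜 := ℝ)) r hr hb x hx0
  obtain ⟨w, hw0, hw1, hw⟩ := ft_hull v _ hxK
  have hv1 : ∀ i, inner ℝ (v i) y ≤ 1 := fun i => hle _ (subset_convexHull ℝ _ ⟨i, rfl⟩)
  have hz : ∀ i, w i * (1 - inner ℝ (v i) y) = 0 := by
    have : ∑ i, w i * (1 - inner ℝ (v i) y) = 0 := by
      rw [hw, sum_inner] at hxy
      simp only [inner_smul_left, RCLike.conj_to_real] at hxy
      simp only [mul_sub, mul_one, Finset.sum_sub_distrib]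
      linarith
    rw [Finset.sum_eq_zero_iff_of_nonneg (fun i _ => mul_nonneg (hw0 i) (by linarith [hv1 i]))] at this
    exact fun i => this i (Finset.mem_univ i)
  -- representations with support of size at most two are impossible
  have hrep : ∀ (S : Finset (Fin n)) (c : Fin n → ℝ), S.card ≤ 2 → t • x ≠ ∑ i ∈ S, c i • v i := by
    intro S c hS he
    apply hx S hS
    have : x = t⁻¹ • ∑ i ∈ S, c i • v i := by rw [← he, smul_smul, inv_mul_cancel₀ ht.ne', one_smul]
    rw [this]
    refine Submodule.smul_mem _ _ (Submodule.sum_mem _ fun i hi => Submodule.smul_mem _ _ (Submodule.subset_span ⟨i, hi, rfl⟩))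
  classical
  set A := Finset.univ.filter (fun i => inner ℝ (v i) y = 1) with hA
  have hA3 : A.card ≤ 3 := hg A y (fun i hi => (Finset.mem_filter.1 hi).2)
  set S := Finset.univ.filter (fun i => w i ≠ 0) with hS
  have hSA : S ⊆ A := by
    intro i hi
    have h1 := (Finset.mem_filter.1 hi).2
    rw [hA, Finset.mem_filter]
    refine ⟨Finset.mem_univ _, ?_⟩
    have := (mul_eq_zero.1 (hz i)).resolve_left h1
    linarith
  have hwS : t • x = ∑ i ∈ S, w i • v i := by
    rw [hw, hS, Finset.sum_filter_of_ne]
    intro i _ h h0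
    exact h (by rw [h0, zero_smul])
  have hS3 : 3 ≤ S.card := by
    by_contra h
    exact hrep S w (by omega) hwS
  have hEq : S = A := Finset.eq_of_subset_of_card_le hSA (by omega)
  have hA3' : A.card = 3 := by rw [hEq] at hS3; omega
  let T : Fin 3 → Fin n := A.orderEmbOfFin hA3'
  have hTm : StrictMono T := (A.orderEmbOfFin hA3').strictMono
  have hTr : Set.range T = A := Finset.range_orderEmbOfFin A hA3'
  have hTA : ∀ i, T i ∈ A := fun i => Finset.orderEmbOfFin_mem A hA3' i
  have hsumT : ∀ g : Fin n → E3, ∑ i ∈ A, g i = ∑ i, g (T i) := by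
    intro g
    have : A = Finset.univ.image T := by
      apply Finset.coe_injective
      rw [← hTr]; simp
    rw [this, Finset.sum_image (fun a _ b _ h => hTm.injective h)]
  have hxT : t • x = ∑ i, w (T i) • v (T i) := by rw [hwS, hEq, hsumT]
  refine ⟨T, y, ⟨hTm, ?_, fun i => (Finset.mem_filter.1 (hTA i)).2, ?_⟩, ?_⟩
  · by_contra hli
    rw [Fintype.not_linearIndependent_iff] at hli
    obtain ⟨g, hg0, k, hk⟩ := hli
    have key : t • x = ∑ i, (w (T i) - w (T k) / g k * g i) • v (T i) := by
      have : ∑ i, (w (T k) / g k * g i) • v (T i) = 0 := by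
        simp only [mul_smul, ← Finset.smul_sum]
        simp only [Function.comp] at hg0
        rw [hg0, smul_zero]
      simp only [sub_smul, Finset.sum_sub_distrib]
      rw [this, sub_zero, hxT]
    let c : Fin n → ℝ := fun j => ∑ i, if T i = j then (w (T i) - w (T k) / g k * g i) else 0
    have hc : ∀ i, c (T i) = w (T i) - w (T k) / g k * g i := by
      intro i
      simp only [c, hTm.injective.eq_iff]
      simp
    refine hrep (A.erase (T k)) c (by rw [Finset.card_erase_of_mem (hTA k), hA3']) ?_
    rw [Finset.sum_erase, hsumT, key]
    · simp only [hc]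
    · rw [hc, div_mul_cancel₀ _ hk, sub_self, zero_smul]
  · intro j hj
    rw [hTr] at hj
    refine lt_of_le_of_ne (hv1 j) (fun h => hj ?_)
    simp [hA, h]
  · refine ⟨fun i => t⁻¹ * w (T i), fun i => ?_, ?_⟩
    · have : T i ∈ S := hEq ▸ hTA i
      have h1 := (Finset.mem_filter.1 this).2
      exact mul_pos (inv_pos.2 ht) (lt_of_le_of_ne (hw0 _) h1.symm)
    · simp only [mul_smul, ← Finset.smul_sum, Function.comp]
      rw [← hxT, smul_smul, inv_mul_cancel₀ ht.ne', one_smul]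


lemma ftMu_univ : ftMu.real Set.univ = 4 * π / 3 := by
  unfold ftMu
  rw [measureReal_restrict_apply MeasurableSet.univ, Set.univ_inter, measureReal_def,
    EuclideanSpace.volume_closedBall_fin_three]
  have := Real.pi_pos
  rw [ENNReal.toReal_mul, ENNReal.toReal_ofReal (by positivity)]
  simp; ring

lemma ft_face_norm {n : ℕ} (v : Fin n → E3) (r : ℝ) (hr : 0 < r)
    (hb : Metric.closedBall 0 r ⊆ convexHull ℝ (Set.range v)) (T : Fin 3 → Fin n) (y : E3)
    (h : ftFace v T y) : r * ‖y‖ ≤ 1 := by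
  have hle : convexHull ℝ (Set.range v) ⊆ {z | inner ℝ z y ≤ 1} := by
    apply convexHull_min
    · rintro _ ⟨j, rfl⟩
      by_cases hj : j ∈ Set.range T
      · obtain ⟨i, rfl⟩ := hj
        exact (h.2.2.1 i).le
      · exact (h.2.2.2 j hj).le
    · exact convex_halfSpace_le (f := fun z : E3 => inner ℝ z y) 
        ⟨fun a b => inner_add_left _ _ _, fun c a => by simp [inner_smul_left]⟩ 1
  have hy0 : y ≠ 0 := by
    rintro rfl
    have := h.2.2.1 0
    simp at this
  have hyn : 0 < ‖y‖ := norm_pos_iff.2 hy0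
  have h1 : (r / ‖y‖) • y ∈ Metric.closedBall (0:E3) r := by
    rw [mem_closedBall_zero_iff, norm_smul, Real.norm_of_nonneg (by positivity)]
    field_simp; rfl
  have := hle (hb h1)
  simp only [Set.mem_ofPred_eq, inner_smul_left, real_inner_self_eq_norm_sq, RCLike.conj_to_real] at this
  field_simp at this
  linarith

lemma ft_tet_sub {n : ℕ} (v : Fin n → E3) (T : Fin 3 → Fin n)
    (h0 : (0:E3) ∈ convexHull ℝ (Set.range v)) : ftTet (v ∘ T) ⊆ convexHull ℝ (Set.range v) := by
  rintro x ⟨a, ha, h1, rfl⟩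
  have hc := convex_convexHull ℝ (Set.range v)
  have := hc.sum_mem (t := (Finset.univ : Finset (Option (Fin 3)))) (w := fun o => o.elim (1 - ∑ i, a i) a)
    (z := fun o => o.elim 0 (v ∘ T)) ?_ ?_ ?_
  · simpa [Fintype.sum_option] using this
  · intro o _
    cases o with
    | none => simp only [Option.elim]; linarith
    | some i => exact (ha i).le
  · simp [Fintype.sum_option]
  · intro o _
    cases o with
    | none => exact h0
    | some i => exact subset_convexHull ℝ _ ⟨T i, rfl⟩

lemma ft_omega (n : ℕ) (hn : 4 ≤ n) : ((n : ℝ) / ((n : ℝ) - 2)) * (π / 6) ∈ Set.Ioo 0 (π / 2) := by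
  have : (4:ℝ) ≤ n := by exact_mod_cast hn
  have h2 : (0:ℝ) < n - 2 := by linarith
  have hp := Real.pi_pos
  constructor
  · positivity
  · have : (n:ℝ) / (n - 2) ≤ 2 := by rw [div_le_iff₀ h2]; linarith
    nlinarith

lemma ftF_zero : ftF (tan (π / 3)) (tan (π / 6)) = 0 := by
  rw [Real.tan_pi_div_three, Real.tan_pi_div_six, ftF]
  have : √3 ^ 2 = 3 := Real.sq_sqrt (by norm_num)
  have h3 : √3 ≠ 0 := by positivity
  field_simp
  simp

lemma ftP_eq (ω : ℝ) : ftP ω = √3 * (3 * tan ω ^ 2 - 1) / 4 := by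
  have : √3 ^ 2 = 3 := Real.sq_sqrt (by norm_num)
  rw [ftP, ftF, this]; norm_num

lemma ft_fan (n : ℕ) (hn : 4 ≤ n) (v : Fin n → E3) (hg : ftGen v) (r : ℝ) (hr : 0 < r)
    (hb : Metric.closedBall 0 r ⊆ convexHull ℝ (Set.range v)) :
    (volume (convexHull ℝ (Set.range v))).toReal ≥
      (Real.sqrt 3 / 2) * ((n : ℝ) - 2) *
        (3 * (Real.tan (((n : ℝ) / ((n : ℝ) - 2)) * (π / 6))) ^ 2 - 1) * r ^ 3 := by
  classical
  have hω := ft_omega n hn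
  set ω := ((n : ℝ) / ((n : ℝ) - 2)) * (π / 6) with hωd
  have h0 : (0:E3) ∈ convexHull ℝ (Set.range v) := hb (Metric.mem_closedBall_self hr.le)
  set 𝒯 : Finset (Fin 3 → Fin n) := Finset.univ.filter (fun T => ∃ y, ftFace v T y) with h𝒯
  have hT : ∀ T ∈ 𝒯, ∃ y, ftFace v T y := fun T h => (Finset.mem_filter.1 h).2
  have hT' : ∀ T y, ftFace v T y → T ∈ 𝒯 := fun T y h => by simp [h𝒯]; exact ⟨y, h⟩
  have hli : ∀ T ∈ 𝒯, LinearIndependent ℝ (v ∘ T) := fun T h => by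
    obtain ⟨y, hy⟩ := hT T h
    exact hy.2.1
  have hdis : ∀ T ∈ 𝒯, ∀ T' ∈ 𝒯, T ≠ T' → Disjoint (ftCone (v ∘ T)) (ftCone (v ∘ T')) := by
    intro T h T' h' hne
    obtain ⟨y, hy⟩ := hT T h
    obtain ⟨y', hy'⟩ := hT T' h'
    exact ft_cone_disj v T T' y y' hy hy' hne
  -- total cone measure
  have hsum : ∑ T ∈ 𝒯, ftMu.real (ftCone (v ∘ T)) = 4 * π / 3 := by
    rw [← measureReal_biUnion_finset (fun T h T' h' hne => hdis T h T' h' hne) 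
      (fun T h => ftCone_meas _ (hli T h)), ← ftMu_univ]
    apply measureReal_congr
    rw [ae_eq_univ]
    have hnull : ftMu (⋃ S ∈ (Finset.univ.filter (fun S : Finset (Fin n) => S.card ≤ 2)), 
        (Submodule.span ℝ (v '' S) : Set E3)) = 0 := by
      refine (measure_biUnion_null_iff (Finset.countable_toSet (Finset.univ.filter (fun S : Finset (Fin n) => S.card ≤ 2)))).2 ?_
      intro S hS
      apply ftMu_null
      intro htop
      have h1 : (S.image v).card ≤ 2 := Finset.card_image_le.trans (Finset.mem_filter.1 hS).2
      have h2 := finrank_span_finset_le_card (R := ℝ) (S.image v)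
      rw [Finset.coe_image, Set.finrank, htop, finrank_top] at h2
      simp at h2
      omega
    refine measure_mono_null ?_ hnull
    intro x hx
    by_contra hcon
    apply hx
    obtain ⟨T, y, hTy, hxT⟩ := ft_cover v hg r hr hb x (by
      intro S hS hxS
      apply hcon
      simp only [Set.mem_iUnion]
      exact ⟨S, by simpa using hS, hxS⟩)
    simp only [Set.mem_iUnion]
    exact ⟨T, hT' T y hTy, hxT⟩
  -- wedges
  have hwedge : ∑ T ∈ 𝒯, ∑ k, ftMu.real (ftW (v ∘ T) k) ≤ n * (4 * π / 3) := by
    rw [← Finset.sum_product' 𝒯 Finset.univ (fun T k => ftMu.real (ftW (v ∘ T) k)),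
      ← Finset.sum_fiberwise (𝒯 ×ˢ Finset.univ) (fun p => p.1 p.2)]
    have : (n:ℝ) * (4 * π / 3) = ∑ _j : Fin n, 4 * π / 3 := by simp
    rw [this]
    apply Finset.sum_le_sum
    intro j _
    rw [← measureReal_biUnion_finset, ← ftMu_univ]
    · exact measureReal_mono (Set.subset_univ _)
    · intro p hp q hq hne
      simp only [Finset.coe_filter, Finset.mem_product, Set.mem_ofPred_eq] at hp hq
      obtain ⟨y, hy⟩ := hT p.1 hp.1.1
      obtain ⟨y', hy'⟩ := hT q.1 hq.1.1
      refine ft_wedge_disj v p.1 q.1 y y' hy hy' ?_ p.2 q.2 (hp.2.trans hq.2.symm)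
      intro h1
      apply hne
      refine Prod.ext h1 ?_
      apply hy'.1.injective
      rw [← h1, hp.2, h1, hq.2]
    · intro p hp
      simp only [Finset.mem_filter, Finset.mem_product] at hp
      exact ftW_meas _ (hli _ hp.1.1) _
  have hgir : 2 * (4 * π / 3) = ∑ T ∈ 𝒯, ∑ k, ftMu.real (ftW (v ∘ T) k) - 𝒯.card * (4 * π / 3 / 2) := by
    rw [← hsum, Finset.mul_sum, Finset.sum_congr rfl (fun T h => ft_girard (v ∘ T) (hli T h)),
      Finset.sum_sub_distrib, hsum, ftMu_univ]
    simp
  have hp := Real.pi_pos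
  have hN : (𝒯.card : ℝ) ≤ 2 * n - 4 := by
    have : π * (𝒯.card : ℝ) ≤ π * (2 * n - 4) := by linarith
    exact le_of_mul_le_mul_left this hp
  -- tetrahedra
  have hvol : (volume (convexHull ℝ (Set.range v))).toReal ≥ ∑ T ∈ 𝒯, (volume (ftTet (v ∘ T))).toReal := by
    have hfin : volume (convexHull ℝ (Set.range v)) ≠ ⊤ :=
      ((Set.finite_range v).isCompact_convexHull (𝕜 := ℝ)).measure_lt_top.ne
    have htc : ∀ T, ftTet (v ∘ T) ⊆ ftCone (v ∘ T) := by
      rintro T x ⟨a, ha, _, hx⟩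
      exact ⟨a, ha, hx⟩
    have := measureReal_biUnion_finset (μ := (volume : Measure E3)) (s := 𝒯) (f := fun T => ftTet (v ∘ T)) 
      (fun T h T' h' hne => (hdis T h T' h' hne).mono (htc T) (htc T')) 
      (fun T h => ftTet_meas _ (hli T h)) (fun T _ => (ftTet_fin _).ne)
    simp only [measureReal_def] at this
    rw [← this]
    apply ENNReal.toReal_mono hfin
    apply measure_mono
    exact Set.iUnion₂_subset fun T _ => ft_tet_sub v T h0
  have hloc : ∑ T ∈ 𝒯, (volume (ftTet (v ∘ T))).toReal ≥ ∑ T ∈ 𝒯, r ^ 3 * (ftP ω + ftB ω / 6 *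
      (3 * ftMu.real (ftCone (v ∘ T)) + π - 6 * ω)) := by
    apply Finset.sum_le_sum
    intro T h
    obtain ⟨y, hy⟩ := hT T h
    have := ft_local ω hω (v ∘ T) hy.2.1 y hy.2.2.1 r hr (ft_face_norm v r hr hb T y hy)
    unfold ftMu
    rw [measureReal_restrict_apply (ftCone_meas _ hy.2.1)]
    exact this
  have hS : ∑ T ∈ 𝒯, r ^ 3 * (ftP ω + ftB ω / 6 * (3 * ftMu.real (ftCone (v ∘ T)) + π - 6 * ω)) 
      = r ^ 3 * (𝒯.card * (ftP ω + ftB ω / 6 * (π - 6 * ω)) + ftB ω / 6 * (4 * π)) := by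
    have : ftB ω / 6 * (4 * π) = ∑ T ∈ 𝒯, ftB ω / 6 * (3 * ftMu.real (ftCone (v ∘ T))) := by
      rw [← Finset.mul_sum, ← Finset.mul_sum, hsum]; ring
    rw [this, ← nsmul_eq_mul, ← Finset.sum_const, ← Finset.sum_add_distrib, Finset.mul_sum]
    apply Finset.sum_congr rfl
    intro T _; ring
  have hneg : ftP ω + ftB ω / 6 * (π - 6 * ω) ≤ 0 := by
    have := ft_tangent ω hω (π / 3) (π / 6) ⟨by linarith, by linarith⟩ ⟨by linarith, by linarith⟩
    rw [ftF_zero] at this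
    linarith
  have hn4 : (4:ℝ) ≤ n := by exact_mod_cast hn
  have hid : (2 * (n:ℝ) - 4) * (π - 6 * ω) = - 4 * π := by
    have : (n:ℝ) - 2 ≠ 0 := by linarith
    rw [hωd]; field_simp; ring
  have hfinal : (𝒯.card : ℝ) * (ftP ω + ftB ω / 6 * (π - 6 * ω)) + ftB ω / 6 * (4 * π) ≥ (2 * n - 4) * ftP ω := by
    have h1 := mul_le_mul_of_nonpos_right hN hneg
    have h2 : (2 * (n:ℝ) - 4) * (ftP ω + ftB ω / 6 * (π - 6 * ω)) = 
      (2 * n - 4) * ftP ω + ftB ω / 6 * ((2 * (n:ℝ) - 4) * (π - 6 * ω)) := by ring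
    rw [h2, hid] at h1
    linarith
  have hr3 : 0 < r ^ 3 := by positivity
  have h5 := mul_le_mul_of_nonneg_left hfinal hr3.le
  rw [hS] at hloc
  calc _ ≥ _ := hvol
    _ ≥ _ := hloc
    _ ≥ _ := h5
    _ = _ := by rw [ftP_eq]; ring


lemma ft_perturb (n : ℕ) (v : Fin n → E3) (ε : ℝ) (hε : 0 < ε) :
    ∃ s : Fin n → ℝ, (∀ i, s i ∈ Set.Ioo (1 / (1 + ε)) 1) ∧ ftGen (fun i => (s i)⁻¹ • v i) := by
  classical
  let L : (S : Finset (Fin n)) → E3 →ₗ[ℝ] (S → ℝ) := fun S => LinearMap.pi (fun i => (innerₗ E3 (v i.1)))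
  let R : (S : Finset (Fin n)) → (Fin n → ℝ) →ₗ[ℝ] (S → ℝ) := fun S => LinearMap.funLeft ℝ ℝ (fun i : S => i.1)
  let M : (S : Finset (Fin n)) → Submodule ℝ (Fin n → ℝ) := fun S => (LinearMap.range (L S)).comap (R S)
  have hM : ∀ S : Finset (Fin n), S.card = 4 → M S ≠ ⊤ := by
    intro S hS htop
    have hsurj : Function.Surjective (R S) := LinearMap.funLeft_surjective_of_injective ℝ ℝ _ Subtype.val_injective
    have hr : LinearMap.range (L S) = ⊤ := by
      rw [eq_top_iff]
      intro f _
      obtain ⟨s, rfl⟩ := hsurj f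
      have : s ∈ M S := by rw [htop]; trivial
      exact this
    have h1 := LinearMap.finrank_range_le (L S)
    rw [hr, finrank_top] at h1
    simp [hS] at h1
  have hnull : volume (⋃ S ∈ (Finset.univ.filter (fun S : Finset (Fin n) => S.card = 4)), (M S : Set (Fin n → ℝ))) = 0 := by
    refine (measure_biUnion_null_iff (Finset.countable_toSet (Finset.univ.filter (fun S : Finset (Fin n) => S.card = 4)))).2 ?_
    intro S hS
    exact Measure.addHaar_submodule _ _ (hM S (Finset.mem_filter.1 hS).2)
  have hlt : 1 / (1 + ε) < 1 := by rw [div_lt_one (by linarith)]; linarith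
  have hpos : 0 < volume (Set.pi Set.univ (fun _ : Fin n => Set.Ioo (1 / (1 + ε)) 1)) := by
    apply IsOpen.measure_pos
    · exact isOpen_set_pi Set.finite_univ (fun _ _ => isOpen_Ioo)
    · rw [Set.univ_pi_nonempty_iff]
      intro i
      exact Set.nonempty_Ioo.2 hlt
  obtain ⟨s, hs, hs'⟩ : ∃ s ∈ Set.pi Set.univ (fun _ : Fin n => Set.Ioo (1 / (1 + ε)) 1), 
      s ∉ (⋃ S ∈ (Finset.univ.filter (fun S : Finset (Fin n) => S.card = 4)), (M S : Set (Fin n → ℝ))) := by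
    by_contra hcon
    push Not at hcon
    exact hpos.ne' (measure_mono_null hcon hnull)
  refine ⟨s, fun i => hs i (Set.mem_univ i), ?_⟩
  intro S y hS
  by_contra hcard
  obtain ⟨S', hS', hc⟩ := Finset.exists_subset_card_eq (s := S) (n := 4) (by omega)
  apply hs'
  simp only [Set.mem_iUnion]
  refine ⟨S', by simpa using hc, y, ?_⟩
  ext i
  have h1 := hS i.1 (hS' i.2)
  have h2 : s i.1 ≠ 0 := by
    have := (hs i.1 (Set.mem_univ _)).1
    have h3 : 0 < 1 / (1 + ε) := by positivity
    linarith
  rw [inner_smul_left] at h1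
  simp only [RCLike.conj_to_real] at h1
  field_simp at h1
  simpa [L, R, LinearMap.funLeft] using h1

open scoped Pointwise in
lemma ft_center (n : ℕ) (hn : 4 ≤ n) (v : Fin n → E3) (r : ℝ) (hr : 0 < r)
    (hb : Metric.closedBall 0 r ⊆ convexHull ℝ (Set.range v)) :
    (volume (convexHull ℝ (Set.range v))).toReal ≥
      (Real.sqrt 3 / 2) * ((n : ℝ) - 2) *
        (3 * (Real.tan (((n : ℝ) / ((n : ℝ) - 2)) * (π / 6))) ^ 2 - 1) * r ^ 3 := by
  set C := (Real.sqrt 3 / 2) * ((n : ℝ) - 2) *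
        (3 * (Real.tan (((n : ℝ) / ((n : ℝ) - 2)) * (π / 6))) ^ 2 - 1) * r ^ 3 with hC
  set K := convexHull ℝ (Set.range v) with hK
  have hKc : Convex ℝ K := convex_convexHull ℝ _
  have h0 : (0:E3) ∈ K := hb (Metric.mem_closedBall_self hr.le)
  have hKfin : volume K ≠ ⊤ := ((Set.finite_range v).isCompact_convexHull (𝕜 := ℝ)).measure_lt_top.ne
  have key : ∀ ε : ℝ, 0 < ε → C ≤ (1 + ε) ^ 3 * (volume K).toReal := by
    intro ε hε
    obtain ⟨s, hs, hg⟩ := ft_perturb n v ε hε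
    set v' : Fin n → E3 := fun i => (s i)⁻¹ • v i with hv'
    have hs0 : ∀ i, 0 < s i := fun i => lt_trans (by positivity) (hs i).1
    have hvv : ∀ i, v i = s i • v' i := fun i => by
      simp only [hv']; rw [smul_smul, mul_inv_cancel₀ (hs0 i).ne', one_smul]
    have hK'c : Convex ℝ (convexHull ℝ (Set.range v')) := convex_convexHull ℝ _
    have h0' : (0:E3) ∈ convexHull ℝ (Set.range v') := by
      obtain ⟨w, hw0, hw1, hw⟩ := ft_hull v 0 h0
      have hp : 0 < ∑ i, w i * s i := by
        apply Finset.sum_pos'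
        · exact fun i _ => mul_nonneg (hw0 i) (hs0 i).le
        · by_contra hcon
          push Not at hcon
          have : ∀ i, w i = 0 := by
            intro i
            have h1 := hcon i (Finset.mem_univ i)
            by_contra hne
            have := mul_pos (lt_of_le_of_ne (hw0 i) (Ne.symm hne)) (hs0 i)
            linarith
          simp [this] at hw1
      have := Finset.centerMass_mem_convexHull (R := ℝ) (s := Set.range v') Finset.univ (w := fun i => w i * s i) (z := v')
        (fun i _ => mul_nonneg (hw0 i) (hs0 i).le) hp (fun i _ => ⟨i, rfl⟩)
      rw [Finset.centerMass] at this
      simp only [mul_smul, ← hvv] at this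
      rwa [← hw, smul_zero] at this
    have hsub : K ⊆ convexHull ℝ (Set.range v') := by
      apply convexHull_min _ hK'c
      rintro _ ⟨i, rfl⟩
      rw [hvv]
      exact hK'c.smul_mem_of_zero_mem h0' (subset_convexHull ℝ _ ⟨i, rfl⟩) ⟨(hs0 i).le, (hs i).2.le⟩
    have hsup : convexHull ℝ (Set.range v') ⊆ (1 + ε) • K := by
      apply convexHull_min _ (hKc.smul _)
      rintro _ ⟨i, rfl⟩
      refine ⟨((1 + ε)⁻¹ * (s i)⁻¹) • v i, ?_, ?_⟩
      · have h1 := (hs i).1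
        rw [div_lt_iff₀ (by linarith)] at h1
        have h2 := hs0 i
        refine hKc.smul_mem_of_zero_mem h0 (subset_convexHull ℝ _ ⟨i, rfl⟩) ⟨by positivity, ?_⟩
        rw [← mul_inv]
        apply inv_le_one_of_one_le₀
        linarith
      · simp only [hv', smul_smul]
        congr 1
        field_simp
    have hfan := ft_fan n hn v' hg r hr (hb.trans hsub)
    rw [← hC] at hfan
    refine le_trans hfan ?_
    have hvol : volume ((1 + ε) • K) = ENNReal.ofReal ((1 + ε) ^ 3) * volume K := by
      rw [Measure.addHaar_smul]
      simp only [finrank_euclideanSpace, Fintype.card_fin]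
      rw [abs_of_nonneg (by positivity)]
    have : (1 + ε) ^ 3 * (volume K).toReal = (volume ((1 + ε) • K)).toReal := by
      rw [hvol, ENNReal.toReal_mul, ENNReal.toReal_ofReal (by positivity)]
    rw [this]
    apply ENNReal.toReal_mono _ (measure_mono hsup)
    rw [hvol]
    exact ENNReal.mul_ne_top ENNReal.ofReal_ne_top hKfin
  have hlim : Filter.Tendsto (fun ε : ℝ => (1 + ε) ^ 3 * (volume K).toReal) (nhdsWithin 0 (Set.Ioi 0)) 
      (nhds ((volume K).toReal)) := by
    have hc : Continuous (fun ε : ℝ => (1 + ε) ^ 3 * (volume K).toReal) := by fun_prop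
    have := hc.tendsto 0
    simp only [add_zero, one_pow, one_mul] at this
    exact this.mono_left nhdsWithin_le_nhds
  exact ge_of_tendsto hlim (by filter_upwards [self_mem_nhdsWithin] with ε hε using key ε hε)

open scoped Pointwise in
lemma ft_main (n : ℕ) (hn : 4 ≤ n)
    (V : Finset (EuclideanSpace ℝ (Fin 3)))
    (P : Set (EuclideanSpace ℝ (Fin 3))) (hP : P = convexHull ℝ (V : Set (EuclideanSpace ℝ (Fin 3))))
    (hext : (Set.extremePoints ℝ P).ncard = n)
    (r : ℝ) (hr : 0 < r) (c : EuclideanSpace ℝ (Fin 3))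
    (hball : Metric.closedBall c r ⊆ P) :
    (volume P).toReal ≥
      (Real.sqrt 3 / 2) * ((n : ℝ) - 2) *
        (3 * (Real.tan (((n : ℝ) / ((n : ℝ) - 2)) * (π / 6))) ^ 2 - 1) * r ^ 3 := by
  have hEfin : (Set.extremePoints ℝ P).Finite := by
    refine V.finite_toSet.subset ?_
    rw [hP]
    exact extremePoints_convexHull_subset
  have hPE : convexHull ℝ (Set.extremePoints ℝ P) = P := by
    have hcomp : IsCompact P := by rw [hP]; exact V.finite_toSet.isCompact_convexHull (𝕜 := ℝ)
    have hconv : Convex ℝ P := by rw [hP]; exact convex_convexHull ℝ _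
    have := closure_convexHull_extremePoints hcomp hconv
    rwa [(hEfin.isClosed_convexHull (𝕜 := ℝ)).closure_eq] at this
  have hcard : hEfin.toFinset.card = n := by rw [← Set.ncard_eq_toFinset_card _ hEfin]; exact hext
  let e := hEfin.toFinset.equivFinOfCardEq hcard
  let v : Fin n → E3 := fun i => -c + (e.symm i : E3)
  have hrange : Set.range v = (-c) +ᵥ (Set.extremePoints ℝ P) := by
    ext x
    constructor
    · rintro ⟨i, rfl⟩
      exact ⟨_, hEfin.mem_toFinset.1 (e.symm i).2, rfl⟩
    · rintro ⟨z, hz, rfl⟩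
      exact ⟨e ⟨z, hEfin.mem_toFinset.2 hz⟩, by simp [v]⟩
  have hhull : convexHull ℝ (Set.range v) = (-c) +ᵥ P := by
    rw [hrange, convexHull_vadd, hPE]
  have hb : Metric.closedBall 0 r ⊆ convexHull ℝ (Set.range v) := by
    rw [hhull]
    intro x hx
    refine ⟨c + x, hball ?_, by simp⟩
    simpa [Metric.mem_closedBall, dist_eq_norm] using hx
  have := ft_center n hn v r hr hb
  rw [hhull, measure_vadd] at this
  exact this



/-- Left-hand side of L. Fejes Tóth's inequality (3) (inradius/vertex version):
if a convex polyhedron in Euclidean 3-space with exactly `n ≥ 4` vertices (extreme points)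
contains a closed ball of radius `r > 0`, then its volume is at least
`(√3/2)·(n−2)·(3·tan²(ωₙ) − 1)·r³` where `ωₙ = (n/(n−2))·(π/6)`. -/
theorem fejes_toth_inradius_bound (n : ℕ) (hn : 4 ≤ n)
    (V : Finset (EuclideanSpace ℝ (Fin 3)))
    (P : Set (EuclideanSpace ℝ (Fin 3))) (hP : P = convexHull ℝ (V : Set (EuclideanSpace ℝ (Fin 3))))
    (hext : (Set.extremePoints ℝ P).ncard = n)
    (r : ℝ) (hr : 0 < r) (c : EuclideanSpace ℝ (Fin 3))
    (hball : Metric.closedBall c r ⊆ P) :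
    (volume P).toReal ≥
      (Real.sqrt 3 / 2) * ((n : ℝ) - 2) *
        (3 * (Real.tan (((n : ℝ) / ((n : ℝ) - 2)) * (π / 6))) ^ 2 - 1) * r ^ 3 := by
  exact ft_main n hn V P hP hext r hr c hball
end

section
/- For any five points p₁,…,p₅ in EuclideanSpace ℝ (Fin 3) each of norm 1 (i.e., lying on the unit sphere), the volume of their convex hull satisfies vol(convexHull ℝ {p₁,…,p₅}) ≤ √3/2. (Berman–Hanes: the maximal volume polyhedron with 5 vertices inscribed in the unit sphere is the triangular bipyramid, of volume sin(2π/3) = √3/2.) -/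
open MeasureTheory Real

def bhS (n : ℕ) (r : ℝ) : Set (Fin n → ℝ) := {x | (∀ i, 0 ≤ x i) ∧ ∑ i, x i ≤ r}

theorem bhS_closed (n : ℕ) (r : ℝ) : IsClosed (bhS n r) := by
  have : bhS n r = (⋂ i, {x | 0 ≤ x i}) ∩ {x | ∑ i, x i ≤ r} := by
    ext x; simp [bhS]
  rw [this]
  refine (isClosed_iInter fun i => isClosed_le (by fun_prop) (by fun_prop)).inter
    (isClosed_le (by fun_prop) (by fun_prop))

theorem bhS_vol (n : ℕ) : ∀ r : ℝ, 0 ≤ r →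
    volume (bhS n r) = ENNReal.ofReal (r ^ n / n.factorial) := by
  induction n with
  | zero =>
    intro r hr
    have : bhS 0 r = Set.univ := by ext x; simp [bhS, hr]
    rw [this, MeasureTheory.volume_pi, Measure.pi_univ]; simp
  | succ n ih =>
    intro r hr
    let e := MeasurableEquiv.piFinSuccAbove (fun _ : Fin (n+1) => ℝ) 0
    have he : MeasurePreserving e := volume_preserving_piFinSuccAbove (fun _ : Fin (n+1) => ℝ) 0
    have hs : MeasurableSet (e.symm ⁻¹' (bhS (n+1) r)) :=
      e.symm.measurable (bhS_closed _ _).measurableSet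
    have h1 : volume (bhS (n+1) r) = volume (e.symm ⁻¹' (bhS (n+1) r)) :=
      ((he.symm e).measure_preimage_equiv _).symm
    rw [h1, Measure.volume_eq_prod, Measure.prod_apply hs]
    have h2 : ∀ t : ℝ, volume (Prod.mk t ⁻¹' (e.symm ⁻¹' (bhS (n+1) r))) =
        (Set.Icc 0 r).indicator (fun t => ENNReal.ofReal ((r - t) ^ n / n.factorial)) t := by
      intro t
      have h3 : (Prod.mk t ⁻¹' (e.symm ⁻¹' (bhS (n+1) r))) =
          {y | 0 ≤ t ∧ y ∈ bhS n (r - t)} := by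
        ext y
        simp [bhS, e, Fin.forall_fin_succ, Fin.sum_univ_succ, and_assoc, le_sub_iff_add_le']
      rw [h3]
      by_cases ht : t ∈ Set.Icc 0 r
      · rw [Set.indicator_of_mem ht, ← ih (r - t) (by linarith [ht.2])]
        simp [ht.1]
      · rw [Set.indicator_of_notMem ht]
        convert measure_empty (μ := (volume : Measure (Fin n → ℝ)))
        ext y
        simp only [Set.mem_ofPred_eq, Set.mem_empty_iff_false, iff_false, bhS]
        rintro ⟨h0, hy, hy'⟩
        exact ht ⟨h0, by linarith [Finset.sum_nonneg (fun i (_ : i ∈ Finset.univ) => hy i)]⟩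
    simp_rw [h2]
    rw [lintegral_indicator measurableSet_Icc, ← ofReal_integral_eq_lintegral_ofReal]
    · congr 1
      rw [integral_Icc_eq_integral_Ioc, ← intervalIntegral.integral_of_le hr]
      rw [intervalIntegral.integral_div,
        intervalIntegral.integral_comp_sub_left (fun t => t ^ n) r]
      simp [Nat.factorial_succ]
      field_simp
    · exact (Continuous.integrableOn_Icc (by fun_prop))
    · refine (ae_restrict_iff' measurableSet_Icc).2 (Filter.Eventually.of_forall fun t ht => ?_)
      have : 0 ≤ r - t := by linarith [ht.2]
      simp only [Pi.zero_apply]; positivity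

abbrev bhE := EuclideanSpace ℝ (Fin 3)

def bhD (u v w : bhE) : ℝ := (!![u 0, v 0, w 0; u 1, v 1, w 1; u 2, v 2, w 2]).det

def bhT (a b c d : bhE) : Set bhE :=
  {x | ∃ u v w : ℝ, 0 ≤ u ∧ 0 ≤ v ∧ 0 ≤ w ∧ u + v + w ≤ 1 ∧
    x = a + (u • (b - a) + v • (c - a) + w • (d - a))}

theorem bhT_vol (a b c d : bhE) : volume (bhT a b c d) ≤
    ENNReal.ofReal (|bhD (b - a) (c - a) (d - a)| / 6) := by
  let B := (EuclideanSpace.basisFun (Fin 3) ℝ).toBasis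
  let M : Matrix (Fin 3) (Fin 3) ℝ := !![(b-a) 0, (c-a) 0, (d-a) 0;
    (b-a) 1, (c-a) 1, (d-a) 1; (b-a) 2, (c-a) 2, (d-a) 2]
  let f := Matrix.toLin B B M
  have hdet : LinearMap.det f = bhD (b - a) (c - a) (d - a) := LinearMap.det_toLin B M
  have hf : ∀ x : bhE, f x = x 0 • (b - a) + x 1 • (c - a) + x 2 • (d - a) := by
    intro x
    ext i
    simp only [f, B, Matrix.toLin_apply]
    fin_cases i <;>
    simp [M, Matrix.mulVec, dotProduct, Fin.sum_univ_three] <;> ring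
  let s : Set bhE := WithLp.ofLp ⁻¹' bhS 3 1
  have hs : volume s = ENNReal.ofReal (1 / 6) := by
    rw [(PiLp.volume_preserving_ofLp (Fin 3)).measure_preimage
      (bhS_closed _ _).measurableSet.nullMeasurableSet, bhS_vol 3 1 zero_le_one]
    norm_num [Nat.factorial]
  have hsub : bhT a b c d ⊆ (fun y => a + y) '' (f '' s) := by
    rintro x ⟨u, v, w, hu, hv, hw, h, rfl⟩
    refine ⟨_, ⟨!₂[u, v, w], ?_, rfl⟩, ?_⟩
    · simp [s, bhS, Fin.forall_fin_succ, Fin.sum_univ_three, *]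
    · simp [hf]
  refine (measure_mono hsub).trans ?_
  rw [Set.image_add_left, measure_preimage_add, Measure.addHaar_image_linearMap, hs, hdet,
    ← ENNReal.ofReal_mul (abs_nonneg _)]
  apply le_of_eq; congr 1; ring

set_option maxHeartbeats 1000000 in
theorem bh_area (a b c v : bhE) (ha : ‖a‖ = 1) (hb : ‖b‖ = 1) (hc : ‖c‖ = 1) (hv : ‖v‖ ≤ 2) :
    |bhD (b - a) (c - a) v| ≤ 3 * √3 := by
  have key : ∀ x : bhE, ‖x‖ ^ 2 = x 0 ^ 2 + x 1 ^ 2 + x 2 ^ 2 := by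
    intro x; simp [EuclideanSpace.norm_sq_eq, Fin.sum_univ_three]
  have ha' := key a
  have hb' := key b
  have hc' := key c
  have hv' := key v
  rw [ha] at ha'; rw [hb] at hb'; rw [hc] at hc'
  have hv2 : v 0 ^ 2 + v 1 ^ 2 + v 2 ^ 2 ≤ 4 := by
    rw [← hv']; nlinarith [norm_nonneg v]
  apply abs_le_of_sq_le_sq _ (by positivity)
  have h3 : (3 * √3) ^ 2 = 27 := by rw [mul_pow, Real.sq_sqrt (by norm_num)]; norm_num
  rw [h3]
  simp only [bhD, Matrix.det_fin_three, PiLp.sub_apply]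
  simp [-PiLp.sub_apply]
  generalize a 0 = a0 at *
  generalize a 1 = a1 at *
  generalize a 2 = a2 at *
  generalize b 0 = b0 at *
  generalize b 1 = b1 at *
  generalize b 2 = b2 at *
  generalize c 0 = c0 at *
  generalize c 1 = c1 at *
  generalize c 2 = c2 at *
  generalize v 0 = v0 at *
  generalize v 1 = v1 at *
  generalize v 2 = v2 at *
  obtain ⟨n0, hn0⟩ : ∃ n, n = (b1 - a1) * (c2 - a2) - (b2 - a2) * (c1 - a1) := ⟨_, rfl⟩
  obtain ⟨n1, hn1⟩ : ∃ n, n = (b2 - a2) * (c0 - a0) - (b0 - a0) * (c2 - a2) := ⟨_, rfl⟩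
  obtain ⟨n2, hn2⟩ : ∃ n, n = (b0 - a0) * (c1 - a1) - (b1 - a1) * (c0 - a0) := ⟨_, rfl⟩
  have hN : n0 ^ 2 + n1 ^ 2 + n2 ^ 2 ≤ 27 / 4 := by
    obtain ⟨x, hx⟩ : ∃ x, x = a0 * b0 + a1 * b1 + a2 * b2 := ⟨_, rfl⟩
    obtain ⟨y, hy⟩ : ∃ x, x = b0 * c0 + b1 * c1 + b2 * c2 := ⟨_, rfl⟩
    obtain ⟨z, hz⟩ : ∃ x, x = a0 * c0 + a1 * c1 + a2 * c2 := ⟨_, rfl⟩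
    have e1 : n0 ^ 2 + n1 ^ 2 + n2 ^ 2 = ((b0-a0)^2+(b1-a1)^2+(b2-a2)^2) *
       ((c0-a0)^2+(c1-a1)^2+(c2-a2)^2) -
       ((b0-a0)*(c0-a0)+(b1-a1)*(c1-a1)+(b2-a2)*(c2-a2))^2 := by
      subst hn0 hn1 hn2; ring
    have e2 : (b0-a0)^2+(b1-a1)^2+(b2-a2)^2 = 2 - 2 * x := by rw [hx]; linear_combination -ha' - hb'
    have e3 : (c0-a0)^2+(c1-a1)^2+(c2-a2)^2 = 2 - 2 * z := by rw [hz]; linear_combination -ha' - hc'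
    have e4 : (b0-a0)*(c0-a0)+(b1-a1)*(c1-a1)+(b2-a2)*(c2-a2) = 1 - x - z + y := by
      rw [hx, hy, hz]; linear_combination -ha'
    have e5 : 0 ≤ 3 + 2 * (x + y + z) := by
      have : 3 + 2 * (x + y + z) = (a0+b0+c0)^2+(a1+b1+c1)^2+(a2+b2+c2)^2 := by
        rw [hx, hy, hz]; linear_combination ha' + hb' + hc'
      rw [this]; positivity
    have bd : ∀ t : ℝ, ∀ p q r p' q' r' : ℝ, p^2+q^2+r^2 = 1 → p'^2+q'^2+r'^2 = 1 →
        t = p*p'+q*q'+r*r' → t ≤ 1 := by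
      intro t p q r p' q' r' h h' h''
      nlinarith [sq_nonneg (p-p'), sq_nonneg (q-q'), sq_nonneg (r-r')]
    have x1 := bd x _ _ _ _ _ _ (by rw [← ha']; norm_num) (by rw [← hb']; norm_num) hx
    have y1 := bd y _ _ _ _ _ _ (by rw [← hb']; norm_num) (by rw [← hc']; norm_num) hy
    have z1 := bd z _ _ _ _ _ _ (by rw [← ha']; norm_num) (by rw [← hc']; norm_num) hz
    rw [e1, e2, e3, e4]
    clear bd e1 e2 e3 e4 hx hy hz hn0 hn1 hn2 ha' hb' hc' hv' hv2 h3
    have e6 : (3 - (x+y+z))^2 ≤ (9/2)^2 := by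
      apply pow_le_pow_left₀ <;> linarith
    nlinarith [sq_nonneg (x-y), sq_nonneg (y-z), sq_nonneg (x-z)]
  have hCS : (n0*v0+n1*v1+n2*v2)^2 ≤ (n0^2+n1^2+n2^2)*(v0^2+v1^2+v2^2) := by
    nlinarith [sq_nonneg (n0*v1-n1*v0), sq_nonneg (n0*v2-n2*v0), sq_nonneg (n1*v2-n2*v1)]
  have hm : (n0^2+n1^2+n2^2)*(v0^2+v1^2+v2^2) ≤ 27/4*4 :=
    mul_le_mul hN hv2 (by positivity) (by norm_num)
  have : (n0*v0+n1*v1+n2*v2)^2 ≤ 27 := by linarith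
  refine le_trans (le_of_eq ?_) this
  rw [hn0, hn1, hn2]; ring

theorem bhD_lin (u v w w' : bhE) (s t : ℝ) :
    bhD u v (s • w + t • w') = s * bhD u v w + t * bhD u v w' := by
  simp [bhD, Matrix.det_fin_three]; ring

theorem bhD_self (u v : bhE) (s t : ℝ) : bhD u v (s • u + t • v) = 0 := by
  simp [bhD, Matrix.det_fin_three]; ring

theorem bh_hull (a b c d e x : bhE) (hx : x ∈ convexHull ℝ ({a, b, c, d, e} : Set bhE)) :
    ∃ i j k l m : ℝ, 0 ≤ i ∧ 0 ≤ j ∧ 0 ≤ k ∧ 0 ≤ l ∧ 0 ≤ m ∧ i + j + k + l + m = 1 ∧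
      x = i • a + j • b + k • c + l • d + m • e := by
  have hsub : ({a, b, c, d, e} : Set bhE) ⊆ {x | ∃ i j k l m : ℝ,
      0 ≤ i ∧ 0 ≤ j ∧ 0 ≤ k ∧ 0 ≤ l ∧ 0 ≤ m ∧ i + j + k + l + m = 1 ∧
      x = i • a + j • b + k • c + l • d + m • e} := by
    rintro y (rfl | rfl | rfl | rfl | rfl)
    · exact ⟨1, 0, 0, 0, 0, by norm_num, by norm_num, by norm_num, by norm_num, by norm_num,
        by norm_num, by module⟩
    · exact ⟨0, 1, 0, 0, 0, by norm_num, by norm_num, by norm_num, by norm_num, by norm_num,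
        by norm_num, by module⟩
    · exact ⟨0, 0, 1, 0, 0, by norm_num, by norm_num, by norm_num, by norm_num, by norm_num,
        by norm_num, by module⟩
    · exact ⟨0, 0, 0, 1, 0, by norm_num, by norm_num, by norm_num, by norm_num, by norm_num,
        by norm_num, by module⟩
    · exact ⟨0, 0, 0, 0, 1, by norm_num, by norm_num, by norm_num, by norm_num, by norm_num,
        by norm_num, by module⟩
  refine convexHull_min hsub ?_ hx
  rintro y ⟨i, j, k, l, m, hi, hj, hk, hl, hm, h, rfl⟩ z
    ⟨i', j', k', l', m', hi', hj', hk', hl', hm', h', rfl⟩ s t hs ht hst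
  refine ⟨s * i + t * i', s * j + t * j', s * k + t * k', s * l + t * l', s * m + t * m',
    by positivity, by positivity, by positivity, by positivity, by positivity, ?_, by module⟩
  linear_combination s * h + t * h' + hst

theorem bhT_of (a b c d x : bhE) (i j k l : ℝ) (hj : 0 ≤ j) (hk : 0 ≤ k) (hl : 0 ≤ l)
    (hi : 0 ≤ i) (h : i + j + k + l = 1) (hx : x = i • a + j • b + k • c + l • d) :
    x ∈ bhT a b c d := by
  refine ⟨j, k, l, hj, hk, hl, by linarith, ?_⟩
  obtain rfl : i = 1 - j - k - l := by linarith
  rw [hx]; module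

theorem bh_case1 (a b c d e : bhE) (ha : ‖a‖ = 1) (hb : ‖b‖ = 1) (hc : ‖c‖ = 1)
    (hd : ‖d‖ = 1) (he : e ∈ convexHull ℝ ({a, b, c, d} : Set bhE)) :
    volume (convexHull ℝ ({a, b, c, d, e} : Set bhE)) ≤ ENNReal.ofReal (√3 / 2) := by
  have hsub : convexHull ℝ ({a, b, c, d, e} : Set bhE) ⊆ bhT a b c d := by
    have h1 : convexHull ℝ ({a, b, c, d, e} : Set bhE) ⊆ convexHull ℝ ({a, b, c, d} : Set bhE) := by
      refine convexHull_min ?_ (convex_convexHull ℝ _)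
      rintro y (rfl | rfl | rfl | rfl | rfl)
      iterate 4 exact subset_convexHull ℝ _ (by simp)
      exact he
    intro x hx
    have h2 := h1 hx
    have h3 : ({a, b, c, d} : Set bhE) = {a, b, c, d, d} := by simp
    rw [h3] at h2
    obtain ⟨i, j, k, l, m, hi, hj, hk, hl, hm, h, hx⟩ := bh_hull _ _ _ _ _ _ h2
    exact bhT_of a b c d x i j k (l + m) hj hk (by positivity) hi (by linarith)
      (by rw [hx]; module)
  refine (measure_mono hsub).trans ((bhT_vol a b c d).trans (ENNReal.ofReal_le_ofReal ?_))
  have := bh_area a b c (d - a) ha hb hc ((norm_sub_le _ _).trans (by rw [hd, ha]; norm_num))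
  linarith

theorem bh_elim (a b c d e x : bhE) (α β γ s t i j k l m : ℝ) (hα : 0 ≤ α) (hβ : 0 ≤ β)
    (hγ : 0 ≤ γ) (h1 : α + β + γ = 1) (hs : 0 ≤ s) (ht : 0 ≤ t) (hst : s + t = 1)
    (hyy : s • d + t • e = α • a + β • b + γ • c)
    (hi : 0 ≤ i) (hj : 0 ≤ j) (hk : 0 ≤ k) (hl : 0 ≤ l) (hm : 0 ≤ m) (h : i + j + k + l + m = 1)
    (hx : x = i • a + j • b + k • c + l • d + m • e) (hle : m * s ≤ l * t) :
    x ∈ bhT a b c d := by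
  rcases ht.eq_or_lt with h0 | htp
  · subst h0
    have hs1 : s = 1 := by linarith
    subst hs1
    have hm0 : m = 0 := by linarith
    subst hm0
    exact bhT_of a b c d x i j k l hj hk hl hi (by linarith) (by rw [hx]; module)
  · have : e = t⁻¹ • (α • a + β • b + γ • c - s • d) := by
      rw [← hyy, add_sub_cancel_left, smul_smul, inv_mul_cancel₀ htp.ne', one_smul]
    refine bhT_of a b c d x (i + m / t * α) (j + m / t * β) (k + m / t * γ) (l - m / t * s)
      (by positivity) (by positivity) ?_ (by positivity) ?_ ?_
    · rw [sub_nonneg, div_mul_eq_mul_div, div_le_iff₀ htp]; exact hle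
    · have : m / t * t = m := by field_simp
      linear_combination h + m / t * h1 - m / t * hst + this
    · rw [hx, this, div_eq_mul_inv]; module

theorem bh_case2 (a b c d e y : bhE) (ha : ‖a‖ = 1) (hb : ‖b‖ = 1) (hc : ‖c‖ = 1)
    (hd : ‖d‖ = 1) (he : ‖e‖ = 1) (hy : y ∈ convexHull ℝ ({a, b, c} : Set bhE))
    (hy' : y ∈ convexHull ℝ ({d, e} : Set bhE)) :
    volume (convexHull ℝ ({a, b, c, d, e} : Set bhE)) ≤ ENNReal.ofReal (√3 / 2) := by
  obtain ⟨α, β, γ, hα, hβ, hγ, h1, rfl⟩ : ∃ α β γ : ℝ, 0 ≤ α ∧ 0 ≤ β ∧ 0 ≤ γ ∧ α + β + γ = 1 ∧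
      y = α • a + β • b + γ • c := by
    have h3 : ({a, b, c} : Set bhE) = {a, b, c, c, c} := by simp
    rw [h3] at hy
    obtain ⟨i, j, k, l, m, hi, hj, hk, hl, hm, h, hx⟩ := bh_hull _ _ _ _ _ _ hy
    exact ⟨i, j, k + l + m, hi, hj, by positivity, by linarith, by rw [hx]; module⟩
  rw [convexHull_pair] at hy'
  obtain ⟨s, t, hs, ht, hst, hyy⟩ := hy'
  have hsub : convexHull ℝ ({a, b, c, d, e} : Set bhE) ⊆ bhT a b c d ∪ bhT a b c e := by
    intro x hx
    obtain ⟨i, j, k, l, m, hi, hj, hk, hl, hm, h, hx⟩ := bh_hull _ _ _ _ _ _ hx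
    rcases le_total (m * s) (l * t) with hle | hle
    · left
      exact bh_elim a b c d e x α β γ s t i j k l m hα hβ hγ h1 hs ht hst hyy hi hj hk hl hm h hx hle
    · right
      exact bh_elim a b c e d x α β γ t s i j k m l hα hβ hγ h1 ht hs (by linarith)
        (by rw [← hyy]; module) hi hj hk hm hl (by linarith) (by rw [hx]; module) hle
  have hD : s * bhD (b - a) (c - a) (d - a) + t * bhD (b - a) (c - a) (e - a) = 0 := by
    rw [← bhD_lin, ← bhD_self (b - a) (c - a) β γ]
    congr 1
    have : s • (d - a) + t • (e - a) = (s • d + t • e) - (s + t) • a := by module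
    rw [this, hyy, hst]
    obtain rfl : α = 1 - β - γ := by linarith
    module
  have hD2 : bhD (b - a) (c - a) (d - e) =
      bhD (b - a) (c - a) (d - a) - bhD (b - a) (c - a) (e - a) := by
    have : d - e = (1 : ℝ) • (d - a) + (-1 : ℝ) • (e - a) := by module
    rw [this, bhD_lin]; ring
  have hA := bh_area a b c (d - e) ha hb hc ((norm_sub_le _ _).trans (by rw [hd, he]; norm_num))
  refine (measure_mono hsub).trans ((measure_union_le _ _).trans
    ((add_le_add (bhT_vol a b c d) (bhT_vol a b c e)).trans ?_))
  rw [← ENNReal.ofReal_add (by positivity) (by positivity)]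
  apply ENNReal.ofReal_le_ofReal
  rw [hD2] at hA
  generalize bhD (b - a) (c - a) (d - a) = P at *
  generalize bhD (b - a) (c - a) (e - a) = Q at *
  have : |P| + |Q| = |P - Q| := by
    have hPQ : P * Q ≤ 0 := by
      have : P * Q = -(t * Q ^ 2) - s * P ^ 2 := by
        linear_combination (P + Q) * hD - P * Q * hst
      rw [this]
      have h1 : 0 ≤ t * Q ^ 2 := by positivity
      have h2 : 0 ≤ s * P ^ 2 := by positivity
      linarith
    rcases mul_nonpos_iff.1 hPQ with ⟨h1, h2⟩ | ⟨h1, h2⟩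
    · rw [abs_of_nonneg h1, abs_of_nonpos h2, abs_of_nonneg (by linarith)]; ring
    · rw [abs_of_nonpos h1, abs_of_nonneg h2, abs_of_nonpos (by linarith)]; ring
  linarith

theorem berman_hanes_five_vertices (p : Fin 5 → EuclideanSpace ℝ (Fin 3))
    (hp : ∀ i, ‖p i‖ = 1) :
    (volume (convexHull ℝ (Set.range p))).toReal ≤ Real.sqrt 3 / 2 := by
  apply ENNReal.toReal_le_of_le_ofReal (by positivity)
  have hdep : ¬ AffineIndependent ℝ p := by
    rw [← finrank_vectorSpan_le_iff_not_affineIndependent ℝ p (n := 3) (by simp)]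
    exact (Submodule.finrank_le _).trans (by simp)
  obtain ⟨I', y, hy, hy'⟩ := Convex.radon_partition hdep
  classical
  obtain ⟨I, rfl⟩ : ∃ I : Finset (Fin 5), I' = ↑I := ⟨I'.toFinset, by simp⟩
  rw [← Finset.coe_compl] at hy'
  have key : ∀ I J : Finset (Fin 5), I ∪ J = Finset.univ → I.card + J.card = 5 → I.card ≤ 2 →
      y ∈ convexHull ℝ (p '' I) → y ∈ convexHull ℝ (p '' J) →
      volume (convexHull ℝ (Set.range p)) ≤ ENNReal.ofReal (√3 / 2) := by
    intro I J hu hc h2 hI hJ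
    have hr : Set.range p = p '' J ∪ p '' I := by
      rw [← Set.image_union, ← Set.image_univ, ← Finset.coe_union, Finset.union_comm, hu,
        Finset.coe_univ]
    interval_cases hI2 : I.card
    · rw [Finset.card_eq_zero] at hI2
      subst hI2; simp at hI
    · have hJ2 : J.card = 4 := by omega
      obtain ⟨i, rfl⟩ := Finset.card_eq_one.1 hI2
      obtain ⟨j, k, l, m, -, -, -, -, -, -, rfl⟩ := Finset.card_eq_four.1 hJ2
      have hr' : Set.range p = {p j, p k, p l, p m, p i} := by
        rw [hr]; ext z; simp [Set.image_insert_eq]; tauto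
      rw [hr']
      have hyi : y = p i := by simpa using hI
      subst hyi
      refine bh_case1 _ _ _ _ _ (hp _) (hp _) (hp _) (hp _) ?_
      simpa [Set.image_insert_eq] using hJ
    · have hJ2 : J.card = 3 := by omega
      obtain ⟨i, j, -, rfl⟩ := Finset.card_eq_two.1 hI2
      obtain ⟨k, l, m, -, -, -, rfl⟩ := Finset.card_eq_three.1 hJ2
      have hr' : Set.range p = {p k, p l, p m, p i, p j} := by
        rw [hr]; ext z; simp [Set.image_insert_eq]; tauto
      rw [hr']
      refine bh_case2 _ _ _ _ _ y (hp _) (hp _) (hp _) (hp _) (hp _) ?_ ?_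
      · simpa [Set.image_insert_eq] using hJ
      · simpa [Set.image_insert_eq] using hI
  have hcard : I.card + Iᶜ.card = 5 := by simpa using Finset.card_add_card_compl I
  rcases le_total I.card 2 with h | h
  · exact key I Iᶜ (by simp) hcard h hy hy'
  · by_cases h' : I.card = 2
    · exact key I Iᶜ (by simp) hcard h'.le hy hy'
    · exact key Iᶜ I (by rw [Finset.union_comm]; simp) (by omega) (by omega) hy' hy
end
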